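/- arXiv:2507.08221 — 3 statements merged into one kernel-verified Lean document; each statement's English description precedes it below -/
import Mathlib

section
/- Let L/K satisfy condition (ram) with parameter n. Then for every σ in the upper ramification group G^n and all α, β in O_L, the trace Tr_{L/K}((σα − α)·β) lies in m_K^{n+1}, the (n+1)-st power of the maximal ideal of O_K. -/
noncomputable section

open scoped Classical

/-- An additive `ℚ ∪ {∞}`-valued valuation on a field `A`, normalized by `v p = 1`.
This models the `p`-adic valuation `v_p` on (an algebraic closure of) `ℚ_p`,
with the convention `v 0 = ∞`. -/
structure PadicValData (A : Type) [Field A] (p : ℕ) : Type where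
  v : A → WithTop ℚ
  v_top_iff : ∀ x : A, v x = ⊤ ↔ x = 0
  v_mul : ∀ x y : A, v (x * y) = v x + v y
  v_min_le_add : ∀ x y : A, min (v x) (v y) ≤ v (x + y)
  v_coe_p : v (p : A) = 1

variable {p : ℕ} {A : Type} [Field A]

/-- `x ∈ F` is a uniformizer of the `p`-adic field `F` (embedded in `A` by `emb`):
its valuation is minimal among the positive valuations of elements of `F`. -/
def IsUniformizer (vd : PadicValData A p) {F : Type} [Field F] (emb : F →+* A) (x : F) : Prop :=
  x ≠ 0 ∧ 0 < vd.v (emb x) ∧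
    ∀ y : F, 0 < vd.v (emb y) → vd.v (emb x) ≤ vd.v (emb y)

/-- `y` belongs to the `j`-th power `m_F^j` of the maximal ideal of the ring of integers
`O_F` of `F` (embedded in `A` by `emb`): `y` is a multiple, by an element of `O_F`, of a
product of `j` elements of the maximal ideal `m_F`.  (For `j = 0` this says `y ∈ O_F`.) -/
def InMaxIdealPow (vd : PadicValData A p) {F : Type} [Field F] (emb : F →+* A) (j : ℕ)
    (y : A) : Prop :=
  ∃ (u : F) (s : Fin j → F), 0 ≤ vd.v (emb u) ∧ (∀ k, 0 < vd.v (emb (s k))) ∧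
    y = emb u * ∏ k, emb (s k)

/-- The lower-numbering ramification set
`G_i = {σ ∈ Gal(L/K) | ∀ x ∈ O_L, σ x - x ∈ m_L^{i+1}}` (with `G_i = G` for `i ≤ -1`). -/
def lowerRamSet (vd : PadicValData A p) (K L : Type) [Field K] [Field L] [Algebra K L]
    (emb : L →+* A) (i : ℤ) : Set (L ≃ₐ[K] L) :=
  {σ | ∀ x : L, 0 ≤ vd.v (emb x) →
    InMaxIdealPow vd emb (i + 1).toNat (emb (σ x) - emb x)}

/-- The Herbrand function `φ_{L/K}(u) = ∫_0^u dt / (G_0 : G_t)`, where `G_t = G_{⌈t⌉}`. -/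
noncomputable def herbrandPhi (vd : PadicValData A p) (K L : Type) [Field K] [Field L]
    [Algebra K L] (emb : L →+* A) (u : ℝ) : ℝ :=
  ∫ t in (0:ℝ)..u,
    (Nat.card ↥(lowerRamSet vd K L emb ⌈t⌉) : ℝ) /
      (Nat.card ↥(lowerRamSet vd K L emb 0) : ℝ)

/-- The Herbrand function `ψ_{L/K}`, the inverse of `φ_{L/K}`. -/
noncomputable def herbrandPsi (vd : PadicValData A p) (K L : Type) [Field K] [Field L]
    [Algebra K L] (emb : L →+* A) (w : ℝ) : ℝ :=
  Function.invFun (herbrandPhi vd K L emb) w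

/-- The upper-numbering ramification set `G^i = G_{ψ_{L/K}(i)}` of `Gal(L/K)`. -/
def upperRamSet (vd : PadicValData A p) (K L : Type) [Field K] [Field L] [Algebra K L]
    (emb : L →+* A) (i : ℤ) : Set (L ≃ₐ[K] L) :=
  lowerRamSet vd K L emb ⌈herbrandPsi vd K L emb (i : ℝ)⌉

/-- Condition (ram): the upper ramification groups of `L/K` satisfy
`G = G^{-1} = G^0 ⊇ G^1 ⊋ G^2 ⊋ ⋯ ⊋ G^n ⊋ G^{n+1} = {1}`, with `G^i/G^{i+1}` of order `p`
for `1 ≤ i ≤ n` and `G^0/G^1` of order `p - 1`. -/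
def RamCond (vd : PadicValData A p) (K L : Type) [Field K] [Field L] [Algebra K L]
    (emb : L →+* A) (n : ℕ) : Prop :=
  upperRamSet vd K L emb (-1) = Set.univ ∧
  upperRamSet vd K L emb 0 = Set.univ ∧
  (∀ i : ℤ, upperRamSet vd K L emb (i + 1) ⊆ upperRamSet vd K L emb i) ∧
  Nat.card ↥(upperRamSet vd K L emb 0)
    = (p - 1) * Nat.card ↥(upperRamSet vd K L emb 1) ∧
  (∀ i : ℕ, 1 ≤ i → i ≤ n →
    Nat.card ↥(upperRamSet vd K L emb (i : ℤ))
      = p * Nat.card ↥(upperRamSet vd K L emb ((i : ℤ) + 1))) ∧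
  upperRamSet vd K L emb ((n : ℤ) + 1) = {1}

/-- The local resolvent `⟨α|χ⟩ = ∑_{γ ∈ Gal(L/K)} χ(γ) γ(α)`, computed in `A`. -/
noncomputable def localResolvent (K L : Type) [Field K] [Field L] [Algebra K L]
    (emb : L →+* A) (χ : (L ≃ₐ[K] L) → A) (α : L) : A :=
  ∑ᶠ γ : L ≃ₐ[K] L, χ γ * emb (γ α)

end

section core
variable {p : ℕ} [Fact p.Prime] {K L : Type} [Field K] [Field L]
  [Algebra ℚ_[p] K] [Algebra K L]

theorem core_discrete (μ : AbsoluteValue K ℝ) (π : K) (h0 : π ≠ 0) (h1 : μ π < 1)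
    (hmin : ∀ y, μ y < 1 → μ y ≤ μ π) (x : K) (hx : x ≠ 0) : ∃ k : ℤ, μ x = μ π ^ k := by
  have hπ : 0 < μ π := μ.pos h0
  have hx' : 0 < μ x := μ.pos hx
  obtain ⟨k, hk⟩ := exists_mem_Ioc_zpow (x := μ x) (y := (μ π)⁻¹) hx' (one_lt_inv_iff₀.2 ⟨hπ, h1⟩)
  simp only [inv_zpow', Set.mem_Ioc] at hk
  -- μπ^(-k) < μ x ≤ μπ^(-(k+1))
  refine ⟨-(k+1), ?_⟩
  have e : μ (x * π ^ (k+1)) = μ x * μ π ^ (k+1) := by simp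
  have hpk : 0 < μ π ^ (k+1) := zpow_pos hπ _
  have hle : μ x * μ π ^ (k+1) ≤ 1 := by
    calc _ ≤ μ π ^ (-(k+1)) * μ π ^ (k+1) := by gcongr; exact hk.2
      _ = 1 := by rw [← zpow_add₀ hπ.ne']; simp
  have hgt : μ π < μ x * μ π ^ (k+1) := by
    calc μ π = μ π ^ (-k) * μ π ^ (k+1) := by rw [← zpow_add₀ hπ.ne']; simp
      _ < _ := by gcongr; exact hk.1
  rcases hle.lt_or_eq with h | h
  · have := hmin _ (e ▸ h)
    rw [e] at this
    linarith
  · rw [zpow_neg]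
    exact eq_inv_of_mul_eq_one_left h

theorem core_unit1 (μ : AbsoluteValue K ℝ) (π : K) (h0 : π ≠ 0) (h1 : μ π < 1)
    (hmin : ∀ y, μ y < 1 → μ y ≤ μ π) (u : ℤ_[p]) (hu : ‖u - 1‖ < 1) :
    μ (algebraMap ℚ_[p] K u) = 1 := by
  have hπ : 0 < μ π := μ.pos h0
  have hroot : ∀ k : ℕ, ∃ y : ℤ_[p], y ^ (p * k + 1) = u := by
    intro k
    have := hensels_lemma (p := p) (F := (Polynomial.X ^ (p * k + 1) - Polynomial.C u : Polynomial ℤ_[p])) (a := 1) ?_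
    · obtain ⟨z, hz, -⟩ := this
      refine ⟨z, ?_⟩
      simpa [sub_eq_zero] using hz
    · have hd : ‖((p * k + 1 : ℕ) : ℤ_[p])‖ = 1 := by
        rw [PadicInt.norm_natCast_eq_one_iff]
        simp
      push_cast at hd
      simp [norm_sub_rev, hd, hu]
  have hu0 : u ≠ 0 := by
    rintro rfl
    simp at hu
  have hne : algebraMap ℚ_[p] K (u : ℚ_[p]) ≠ 0 := by simpa using hu0
  obtain ⟨c, hc⟩ := core_discrete μ π h0 h1 hmin _ hne
  obtain ⟨y, hy⟩ := hroot c.natAbs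
  have hy0 : y ≠ 0 := by
    rintro rfl
    simp at hy
    exact hu0 hy.symm
  have hyne : algebraMap ℚ_[p] K (y : ℚ_[p]) ≠ 0 := by simpa using hy0
  obtain ⟨d, hd⟩ := core_discrete μ π h0 h1 hmin _ hyne
  have e : (μ π) ^ c = (μ π) ^ (d * ((p * c.natAbs + 1 : ℕ) : ℤ)) := by
    rw [zpow_mul, ← hd, ← hc, ← hy, zpow_natCast]
    simp
  have e2 := zpow_right_injective₀ hπ h1.ne e
  have hc0 : c = 0 := by
    have hp2 : 2 ≤ p := (Fact.out : p.Prime).two_le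
    by_contra hcne
    have h3 : ((p * c.natAbs + 1 : ℕ) : ℤ) ∣ c := ⟨d, by simpa only [mul_comm] using e2⟩
    have := Int.natAbs_dvd_natAbs.2 h3
    have := Nat.le_of_dvd (by omega) this
    simp only [Int.natAbs_natCast] at this
    have := Nat.le_mul_of_pos_left c.natAbs (show 0 < p by omega)
    omega
  rw [hc, hc0, zpow_zero]

theorem core_padic (μ : AbsoluteValue K ℝ) (π : K) (h0 : π ≠ 0) (h1 : μ π < 1)
    (hmin : ∀ y, μ y < 1 → μ y ≤ μ π) (hp : μ (p : K) = (p : ℝ)⁻¹) (c : ℚ_[p]) :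
    μ (algebraMap ℚ_[p] K c) = ‖c‖ := by
  have hp2 : 2 ≤ p := (Fact.out : p.Prime).two_le
  have hunit : ∀ u : ℤ_[p], ‖u‖ = 1 → μ (algebraMap ℚ_[p] K u) = 1 := by
    intro u hu
    have h := core_unit1 μ π h0 h1 hmin (u ^ (p - 1)) ?_
    · have h' : μ (algebraMap ℚ_[p] K u) ^ (p - 1) = 1 := by simpa using h
      exact (pow_eq_one_iff_of_nonneg (μ.nonneg _) (by omega)).1 h'
    · have : u ^ (p-1) - 1 ∈ IsLocalRing.maximalIdeal ℤ_[p] := by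
        rw [← PadicInt.ker_toZMod, RingHom.mem_ker, map_sub, map_pow, map_one, sub_eq_zero]
        apply ZMod.pow_card_sub_one_eq_one
        intro h
        have : u ∈ IsLocalRing.maximalIdeal ℤ_[p] := by
          rw [← PadicInt.ker_toZMod, RingHom.mem_ker, h]
        rw [IsLocalRing.mem_maximalIdeal, PadicInt.mem_nonunits] at this
        linarith
      rwa [IsLocalRing.mem_maximalIdeal, PadicInt.mem_nonunits] at this
  by_cases hc : c = 0
  · simp [hc]
  have hpne : (p : ℚ_[p]) ≠ 0 := by simpa using (by omega : p ≠ 0)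
  set u := c * (p : ℚ_[p]) ^ (-c.valuation) with hu
  have hnu : ‖u‖ = 1 := by
    rw [hu, norm_mul, Padic.norm_eq_zpow_neg_valuation hc, norm_zpow, Padic.norm_p, inv_zpow', 
      neg_neg, ← zpow_add₀ (by positivity)]
    simp
  have e : c = u * (p : ℚ_[p]) ^ (c.valuation) := by
    rw [hu, mul_assoc, ← zpow_add₀ hpne]; simp
  have h2 := hunit ⟨u, hnu.le⟩ hnu
  simp only at h2
  rw [e, map_mul, map_mul, h2, norm_mul, hnu, map_zpow₀, map_zpow₀, map_natCast, hp, norm_zpow,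
    Padic.norm_p]
end core

section core2
variable {p : ℕ} [Fact p.Prime] {K L : Type} [Field K] [Field L]
  [Algebra ℚ_[p] L] [FiniteDimensional ℚ_[p] L] [Algebra ℤ_[p] L] [IsScalarTower ℤ_[p] ℚ_[p] L]

theorem core_inv (ν : AbsoluteValue L ℝ) (hν : ∀ c : ℚ_[p], ν (algebraMap ℚ_[p] L c) = ‖c‖)
    (σ : L ≃ₐ[ℚ_[p]] L) (x : L) : ν (σ x) = ν x := by
  rw [spectralNorm_unique_field_norm_ext hν, spectralNorm_unique_field_norm_ext hν,
    ← spectralNorm_eq_of_equiv]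

theorem core_integral (ν : AbsoluteValue L ℝ) (hν : ∀ c : ℚ_[p], ν (algebraMap ℚ_[p] L c) = ‖c‖)
    (x : L) (hx : ν x ≤ 1) : IsIntegral ℤ_[p] x := by
  have hi : IsIntegral ℚ_[p] x := Algebra.IsIntegral.isIntegral x
  rw [spectralNorm_unique_field_norm_ext hν, spectralNorm, 
    spectralValue_le_one_iff (minpoly.monic hi)] at hx
  have hl : minpoly ℚ_[p] x ∈ Polynomial.lifts (algebraMap ℤ_[p] ℚ_[p]) := by
    rw [Polynomial.lifts_iff_coeff_lifts]
    intro n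
    exact ⟨⟨_, hx n⟩, rfl⟩
  obtain ⟨q, hq, -, hm⟩ := Polynomial.lifts_and_degree_eq_and_monic hl (minpoly.monic hi)
  refine ⟨q, hm, ?_⟩
  rw [← Polynomial.aeval_def, ← Polynomial.aeval_map_algebraMap ℚ_[p], hq, minpoly.aeval]

/-- the valuation ring as a `ℤ_p`-submodule -/
def coreO (ν : AbsoluteValue L ℝ) (hna : IsNonarchimedean ν)
    (hν : ∀ c : ℚ_[p], ν (algebraMap ℚ_[p] L c) = ‖c‖) : Submodule ℤ_[p] L where
  carrier := {x | ν x ≤ 1}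
  zero_mem' := by simp
  add_mem' := fun {a b} ha hb => (hna a b).trans (max_le ha hb)
  smul_mem' := fun c x hx => by
    have : ν (algebraMap ℤ_[p] L c) = ‖c‖ := by
      rw [IsScalarTower.algebraMap_apply ℤ_[p] ℚ_[p] L, hν]; rfl
    simp only [Set.mem_ofPred_eq] at *
    rw [Algebra.smul_def, map_mul, this]
    exact mul_le_one₀ c.norm_le_one (ν.nonneg _) hx

theorem coreO_fg (ν : AbsoluteValue L ℝ) (hna : IsNonarchimedean ν)
    (hν : ∀ c : ℚ_[p], ν (algebraMap ℚ_[p] L c) = ‖c‖) : (coreO ν hna hν).FG := by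
  have : CharZero L := charZero_of_injective_algebraMap (algebraMap ℚ_[p] L).injective
  have hn : IsNoetherian ℤ_[p] (integralClosure ℤ_[p] L) :=
    IsIntegralClosure.isNoetherian ℤ_[p] ℚ_[p] L _
  have hn' : IsNoetherian ℤ_[p] (Subalgebra.toSubmodule (integralClosure ℤ_[p] L)) := hn
  have hle : coreO ν hna hν ≤ Subalgebra.toSubmodule (integralClosure ℤ_[p] L) :=
    fun x hx => core_integral ν hν x hx
  exact Submodule.fg_top _ |>.1 ((isNoetherian_of_le hle).noetherian ⊤)
end core2
section core3
variable {p : ℕ} [Fact p.Prime] {K L : Type} [Field K] [Field L]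

/-- valuation subring of an absolute value -/
def coreV (ν : AbsoluteValue L ℝ) (hna : IsNonarchimedean ν) : ValuationSubring L where
  carrier := {x | ν x ≤ 1}
  zero_mem' := by simp
  one_mem' := by simp
  add_mem' := fun {a b} ha hb => (hna a b).trans (max_le ha hb)
  mul_mem' := fun {a b} ha hb => by
    simp only [Set.mem_ofPred_eq, map_mul] at *
    exact mul_le_one₀ ha (ν.nonneg _) hb
  neg_mem' := fun {a} ha => by simpa using ha
  mem_or_inv_mem' := fun x => by
    rcases le_total (ν x) 1 with h | h
    · left; exact h
    · right; simpa using inv_le_one_of_one_le₀ h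

theorem coreV_mem (ν : AbsoluteValue L ℝ) (hna : IsNonarchimedean ν) (x : L) :
    x ∈ coreV ν hna ↔ ν x ≤ 1 := Iff.rfl

theorem core_sum (ν : AbsoluteValue L ℝ) (hna : IsNonarchimedean ν) {ι : Type*} (s : Finset ι)
    (f : ι → L) (C : ℝ) (hC : 0 ≤ C) (h : ∀ i ∈ s, ν (f i) ≤ C) : ν (∑ i ∈ s, f i) ≤ C := by
  classical
  induction s using Finset.induction_on with
  | empty => simpa using hC
  | insert a s ha ih =>
    rw [Finset.sum_insert ha]
    exact (hna _ _).trans (max_le (h _ (by simp)) (ih fun i hi => h i (by simp [hi])))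

theorem core_sub (ν : AbsoluteValue L ℝ) (hna : IsNonarchimedean ν) (a b : L) (C : ℝ)
    (ha : ν a ≤ C) (hb : ν b ≤ C) : ν (a - b) ≤ C := by
  rw [sub_eq_add_neg]
  exact (hna _ _).trans (max_le ha (by simpa using hb))

theorem core_sub_lt (ν : AbsoluteValue L ℝ) (hna : IsNonarchimedean ν) (a b : L) (C : ℝ)
    (ha : ν a < C) (hb : ν b < C) : ν (a - b) < C := by
  rw [sub_eq_add_neg]
  exact (hna _ _).trans_lt (max_lt ha (by simpa using hb))

/-- Frobenius mod p -/
theorem core_frob (ν : AbsoluteValue L ℝ) (hna : IsNonarchimedean ν) (n : ℕ) (x y : L)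
    (hx : ν x ≤ 1) (hy : ν y ≤ 1) :
    ν ((x + y) ^ p ^ n - x ^ p ^ n - y ^ p ^ n) ≤ ν (p : L) := by
  obtain ⟨r, hr⟩ := exists_add_pow_prime_pow_eq (Fact.out : p.Prime) 
    (⟨x, hx⟩ : coreV ν hna) (⟨y, hy⟩ : coreV ν hna) n
  have h := congrArg (Subtype.val) hr
  push_cast at h
  have e : (x + y) ^ p ^ n - x ^ p ^ n - y ^ p ^ n = p * (x * y * (r : L)) := by
    rw [h]; ring
  rw [e, map_mul, map_mul, map_mul]
  have hr1 : ν (r : L) ≤ 1 := r.2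
  calc _ ≤ ν (p : L) * (1 * 1 * 1) := by
        gcongr
    _ = _ := by ring

theorem core_pow_close (ν : AbsoluteValue L ℝ) (hna : IsNonarchimedean ν) (n : ℕ) (x y : L)
    (hx : ν x ≤ 1) (hy : ν y ≤ 1) (h0 : (p : L) ≠ 0) (h : ν (x - y) ≤ ν (p : L)) (k : ℕ) :
    ν (x ^ p ^ k - y ^ p ^ k) ≤ ν (p : L) ^ (k + 1) := by
  have hp0 : 0 < ν (p : L) := ν.pos h0
  have hd : ((p : ℕ) : coreV ν hna) ∣ (⟨x, hx⟩ : coreV ν hna) - ⟨y, hy⟩ := by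
    refine ⟨⟨(x - y) / p, ?_⟩, ?_⟩
    · rw [coreV_mem, map_div₀]; exact div_le_one_of_le₀ h (ν.nonneg _)
    · apply Subtype.ext
      push_cast
      field_simp
  obtain ⟨r, hr⟩ := dvd_sub_pow_of_dvd_sub hd k
  have h := congrArg (Subtype.val) hr
  push_cast at h
  rw [h, map_mul, map_pow]
  exact mul_le_of_le_one_right (by positivity) r.2

theorem core_finite [Algebra ℚ_[p] L] [FiniteDimensional ℚ_[p] L] [Algebra ℤ_[p] L]
    [IsScalarTower ℤ_[p] ℚ_[p] L] (ν : AbsoluteValue L ℝ) (hna : IsNonarchimedean ν)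
    (hν : ∀ c : ℚ_[p], ν (algebraMap ℚ_[p] L c) = ‖c‖) (x : L) (hx : ν x ≤ 1) :
    ∃ f : ℕ, 1 ≤ f ∧ ν (x ^ p ^ f - x) < 1 := by
  have hp2 : 2 ≤ p := (Fact.out : p.Prime).two_le
  have hνp : ν (p : L) < 1 := by
    have := hν p
    rw [map_natCast] at this
    rw [this]; exact Padic.norm_p_lt_one
  set I : Ideal ℤ_[p] := Ideal.span {(p : ℤ_[p])} with hI
  have : Finite (ℤ_[p] ⧸ I) := by
    rw [hI, ← PadicInt.maximalIdeal_eq_span_p]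
    exact inferInstanceAs (Finite (IsLocalRing.ResidueField ℤ_[p]))
  have hfin : Finite ((coreO ν hna hν) ⧸ (I • (⊤ : Submodule ℤ_[p] (coreO ν hna hν)))) := by
    apply Submodule.finite_quotient_smul
    exact (Submodule.fg_top _).2 (coreO_fg ν hna hν)
  have hpow : ∀ m : ℕ, ν (x ^ m) ≤ 1 := fun m => by
    rw [map_pow]; exact pow_le_one₀ (ν.nonneg _) hx
  obtain ⟨i, j, hij, h⟩ := Finite.exists_ne_map_eq_of_infinite 
    (fun i : ℕ => (Submodule.Quotient.mk (⟨x ^ p ^ i, hpow _⟩ : coreO ν hna hν) : 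
      (coreO ν hna hν) ⧸ (I • (⊤ : Submodule ℤ_[p] (coreO ν hna hν)))))
  wlog hlt : i < j generalizing i j with H
  · exact H j i hij.symm h.symm (by omega)
  rw [eq_comm, Submodule.Quotient.eq, hI, Submodule.ideal_span_singleton_smul] at h
  obtain ⟨y, -, hy⟩ := h
  have hy' := congrArg Subtype.val hy
  simp only [DistribSMul.toLinearMap_apply, Submodule.coe_smul, Submodule.coe_sub] at hy'
  rw [Algebra.smul_def, map_natCast] at hy'
  refine ⟨j - i, by omega, ?_⟩
  have h1 : ν (x ^ p ^ j - x ^ p ^ i) ≤ ν (p : L) := by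
    rw [← hy', map_mul]
    exact mul_le_of_le_one_right (ν.nonneg _) y.2
  have hz : (x ^ p ^ (j - i)) ^ p ^ i = x ^ p ^ j := by
    rw [← pow_mul, ← pow_add]; congr 2; omega
  have h2 := core_frob (p := p) ν hna i (x ^ p ^ (j - i) - x) x (core_sub _ hna _ _ _ (hpow _) hx) hx
  rw [sub_add_cancel, hz] at h2
  have h3 : ν ((x ^ p ^ (j - i) - x) ^ p ^ i) ≤ ν (p : L) := by
    have := core_sub ν hna _ _ _ h1 h2
    have e : x ^ p ^ j - x ^ p ^ i - (x ^ p ^ j - (x ^ p ^ (j - i) - x) ^ p ^ i - x ^ p ^ i) =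
      (x ^ p ^ (j - i) - x) ^ p ^ i := by ring
    rwa [e] at this
  rw [map_pow] at h3
  by_contra hcon
  push Not at hcon
  have := one_le_pow₀ (n := p ^ i) hcon
  linarith

theorem core_finite_mul (ν : AbsoluteValue L ℝ) (hna : IsNonarchimedean ν) (x : L) (hx : ν x ≤ 1)
    (f : ℕ) (hf : ν (x ^ p ^ f - x) < 1) (k : ℕ) : ν (x ^ p ^ (f * k) - x) < 1 := by
  have hpow : ∀ m : ℕ, ν (x ^ m) ≤ 1 := fun m => by
    rw [map_pow]; exact pow_le_one₀ (ν.nonneg _) hx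
  induction k with
  | zero => simp
  | succ k ih =>
    have e : x ^ p ^ (f * (k + 1)) - x = (x ^ p ^ f - x) - ((x ^ p ^ f) - (x ^ p ^ f) ^ p ^ (f * k)) := by
      rw [← pow_mul x, ← pow_add]; ring_nf
    rw [e]
    apply core_sub_lt ν hna _ _ _ hf
    obtain ⟨r, hr⟩ := sub_dvd_pow_sub_pow (⟨x, hx⟩ : coreV ν hna) ⟨x ^ p ^ (f * k), hpow _⟩ (p ^ f)
    have h := congrArg (Subtype.val) hr
    push_cast at h
    rw [← pow_mul, mul_comm (p ^ f), pow_mul, h, map_mul, ν.map_sub]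
    exact (mul_le_of_le_one_right (ν.nonneg _) r.2).trans_lt ih

theorem core_residue [Algebra ℚ_[p] L] [FiniteDimensional ℚ_[p] L] [Algebra ℤ_[p] L]
    [IsScalarTower ℤ_[p] ℚ_[p] L] [Algebra K L] [FiniteDimensional K L] [IsGalois K L]
    (ν : AbsoluteValue L ℝ) (hna : IsNonarchimedean ν)
    (hν : ∀ c : ℚ_[p], ν (algebraMap ℚ_[p] L c) = ‖c‖) (ϖ : L) (hϖ : ν ϖ < 1)
    (hinv : ∀ (σ : L ≃ₐ[K] L) x, ν (σ x) = ν x)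
    (htot : ∀ (σ : L ≃ₐ[K] L) x, ν x ≤ 1 → ν (σ x - x) ≤ ν ϖ)
    (x : L) (hx : ν x ≤ 1) : ∃ a : K, ν (x - algebraMap K L a) < 1 := by
  have hp2 : 2 ≤ p := (Fact.out : p.Prime).two_le
  have : CharZero L := charZero_of_injective_algebraMap (algebraMap ℚ_[p] L).injective
  have hp0 : (p : L) ≠ 0 := by exact_mod_cast (by omega : p ≠ 0)
  have hνp0 : 0 < ν (p : L) := ν.pos hp0
  have hνp : ν (p : L) < 1 := by
    have := hν p
    rw [map_natCast] at this
    rw [this]; exact Padic.norm_p_lt_one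
  obtain ⟨f, hf1, hf⟩ := core_finite ν hna hν x hx
  have hpow : ∀ m : ℕ, ν (x ^ m) ≤ 1 := fun m => by
    rw [map_pow]; exact pow_le_one₀ (ν.nonneg _) hx
  obtain ⟨i, hi⟩ := exists_pow_lt_of_lt_one hνp0 hϖ
  set N : ℕ := Fintype.card (L ≃ₐ[K] L) with hN
  have hN0 : (N : L) ≠ 0 := by exact_mod_cast Fintype.card_ne_zero
  obtain ⟨k, hk⟩ := exists_pow_lt_of_lt_one (ν.pos hN0) hνp
  have hi' : i ≤ p ^ i := (Nat.lt_pow_self (by omega)).le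
  have c1 : ∀ σ : L ≃ₐ[K] L, ν ((σ x) ^ p ^ i - x ^ p ^ i) ≤ ν (p : L) := by
    intro σ
    have h2 := core_frob (p := p) ν hna i (σ x - x) x 
      (core_sub _ hna _ _ _ (by rw [hinv]; exact hx) hx) hx
    rw [sub_add_cancel] at h2
    have h3 : ν ((σ x - x) ^ p ^ i) ≤ ν (p : L) := by
      rw [map_pow]
      calc _ ≤ ν ϖ ^ p ^ i := by gcongr; exact htot σ x hx
        _ ≤ ν ϖ ^ i := pow_le_pow_of_le_one (ν.nonneg _) hϖ.le hi'
        _ ≤ _ := hi.le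
    have := (hna _ _).trans (max_le h2 h3)
    have e : (σ x) ^ p ^ i - (σ x - x) ^ p ^ i - x ^ p ^ i + (σ x - x) ^ p ^ i =
      (σ x) ^ p ^ i - x ^ p ^ i := by ring
    rwa [e] at this
  have hj : i + k ≤ f * (i + k) := Nat.le_mul_of_pos_left _ hf1
  set j := f * (i + k) with hjdef
  have c2 : ∀ σ : L ≃ₐ[K] L, ν ((σ x) ^ p ^ j - x ^ p ^ j) < ν (N : L) := by
    intro σ
    have h := core_pow_close ν hna 0 ((σ x) ^ p ^ i) (x ^ p ^ i) 
      (by rw [← map_pow, hinv]; exact hpow _) (hpow _) hp0 (c1 σ) (j - i)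
    rw [← pow_mul, ← pow_mul, ← pow_add, show i + (j - i) = j by omega] at h
    refine h.trans_lt (lt_of_le_of_lt ?_ hk)
    exact pow_le_pow_of_le_one (ν.nonneg _) hνp.le (by omega)
  refine ⟨Algebra.trace K L (x ^ p ^ j) / N, ?_⟩
  have e : x - algebraMap K L (Algebra.trace K L (x ^ p ^ j) / N) = 
     - (∑ σ : L ≃ₐ[K] L, ((σ x) ^ p ^ j - x ^ p ^ j)) / N - (x ^ p ^ j - x) := by
    rw [map_div₀, trace_eq_sum_automorphisms, Finset.sum_sub_distrib]
    simp only [map_pow, map_natCast, Finset.sum_const, Finset.card_univ, ← hN, nsmul_eq_mul]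
    field_simp
    ring
  rw [e]
  apply core_sub_lt ν hna
  · rw [map_div₀, ν.map_neg, div_lt_one (ν.pos hN0)]
    obtain ⟨σ0, -, h0⟩ := Finset.exists_max_image (Finset.univ : Finset (L ≃ₐ[K] L)) 
      (fun σ => ν ((σ x) ^ p ^ j - x ^ p ^ j)) ⟨1, by simp⟩
    exact (core_sum ν hna _ _ _ (ν.nonneg _) h0).trans_lt (c2 σ0)
  · exact core_finite_mul ν hna x hx f hf _
end core3
section core4
variable {p : ℕ} [Fact p.Prime] {K L : Type} [Field K] [Field L] [Algebra K L]

theorem core_unif [FiniteDimensional K L] [IsGalois K L]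
    (ν : AbsoluteValue L ℝ) (hinv : ∀ (σ : L ≃ₐ[K] L) x, ν (σ x) = ν x)
    (π : K) (h0 : π ≠ 0) (h1 : ν (algebraMap K L π) < 1)
    (hmin : ∀ y : K, ν (algebraMap K L y) < 1 → ν (algebraMap K L y) ≤ ν (algebraMap K L π)) :
    ∃ ϖ : L, ϖ ≠ 0 ∧ ν ϖ < 1 ∧ (∀ y, ν y < 1 → ν y ≤ ν ϖ) ∧
      ν ϖ ^ (Nat.card (L ≃ₐ[K] L)) ≤ ν (algebraMap K L π) := by
  classical
  rw [Nat.card_eq_fintype_card]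
  set N := Fintype.card (L ≃ₐ[K] L) with hN
  have hN0 : N ≠ 0 := Fintype.card_ne_zero
  set ρ := ν (algebraMap K L π) with hρ
  have hπL : algebraMap K L π ≠ 0 := by simpa using h0
  have hρ0 : 0 < ρ := ν.pos hπL
  have hnorm : ∀ x : L, ν (algebraMap K L (Algebra.norm K x)) = ν x ^ N := by
    intro x
    rw [Algebra.norm_eq_prod_automorphisms, map_prod]
    simp [hinv, hN]
  have hdisc : ∀ x : L, x ≠ 0 → ν x < 1 → ∃ k : ℕ, ν x ^ N = ρ ^ k := by
    intro x hx hx1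
    have hnz : Algebra.norm K x ≠ 0 := Algebra.norm_ne_zero_iff.2 hx
    obtain ⟨k, hk⟩ := core_discrete (ν.comp (algebraMap K L).injective) π h0 h1 hmin _ hnz
    have hk' : ν x ^ N = ρ ^ k := by rw [← hnorm]; exact hk
    have hk0 : 0 ≤ k := by
      by_contra hneg
      push Not at hneg
      have h2 : 1 < ρ ^ k := one_lt_zpow_of_neg₀ hρ0 h1 hneg
      have h3 : ν x ^ N ≤ 1 := pow_le_one₀ (ν.nonneg _) hx1.le
      linarith
    lift k to ℕ using hk0
    exact ⟨k, by simpa using hk'⟩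
  have hex : ∃ k : ℕ, ∃ x : L, x ≠ 0 ∧ ν x < 1 ∧ ν x ^ N = ρ ^ k := by
    obtain ⟨k, hk⟩ := hdisc _ hπL h1
    exact ⟨k, _, hπL, h1, hk⟩
  obtain ⟨ϖ, a1, a2, a3⟩ := Nat.find_spec hex
  refine ⟨ϖ, a1, a2, ?_, ?_⟩
  · intro y hy
    by_cases hy0 : y = 0
    · simp [hy0]
    obtain ⟨k, hk⟩ := hdisc y hy0 hy
    have := Nat.find_min' hex ⟨y, hy0, hy, hk⟩
    refine le_of_pow_le_pow_left₀ hN0 (ν.nonneg _) ?_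
    rw [hk, a3]
    exact pow_le_pow_of_le_one hρ0.le h1.le this
  · rw [← hnorm]
    apply hmin
    rw [hnorm]
    exact pow_lt_one₀ (ν.nonneg _) a2 hN0

theorem core_gen [Algebra ℚ_[p] K] [Algebra ℚ_[p] L] [IsScalarTower ℚ_[p] K L]
    [FiniteDimensional ℚ_[p] L] [Algebra ℤ_[p] L]
    [IsScalarTower ℤ_[p] ℚ_[p] L] 
    (ν : AbsoluteValue L ℝ) (hna : IsNonarchimedean ν)
    (hν : ∀ c : ℚ_[p], ν (algebraMap ℚ_[p] L c) = ‖c‖) (ϖ : L) (hϖ0 : ϖ ≠ 0) (hϖ : ν ϖ < 1)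
    (hmax : ∀ y, ν y < 1 → ν y ≤ ν ϖ)
    (hres : ∀ x, ν x ≤ 1 → ∃ a : K, ν (x - algebraMap K L a) < 1)
    (O : ValuationSubring K) (hO : ∀ x : K, x ∈ O ↔ ν (algebraMap K L x) ≤ 1)
    (x : L) (hx : ν x ≤ 1) : x ∈ Algebra.adjoin O {ϖ} := by
  have hp2 : 2 ≤ p := (Fact.out : p.Prime).two_le
  have : CharZero L := charZero_of_injective_algebraMap (algebraMap ℚ_[p] L).injective
  have hp0 : (p : L) ≠ 0 := by exact_mod_cast (by omega : p ≠ 0)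
  have hνp0 : 0 < ν (p : L) := ν.pos hp0
  have hϖ00 : 0 < ν ϖ := ν.pos hϖ0
  have hOm : ∀ a : K, ν (algebraMap K L a) ≤ 1 → algebraMap K L a ∈ Algebra.adjoin O {ϖ} := by
    intro a ha
    exact Subalgebra.algebraMap_mem _ (⟨a, (hO a).2 ha⟩ : O)
  let M : Submodule ℤ_[p] L := 
    { carrier := {x | x ∈ Algebra.adjoin O {ϖ}}
      zero_mem' := zero_mem (Algebra.adjoin O {ϖ})
      add_mem' := fun {a b} ha hb => (Algebra.adjoin O {ϖ}).add_mem ha hb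
      smul_mem' := fun c x hx => by
        have e : algebraMap ℤ_[p] L c = algebraMap K L (algebraMap ℚ_[p] K c) := by
          rw [IsScalarTower.algebraMap_apply ℤ_[p] ℚ_[p] L, ← IsScalarTower.algebraMap_apply ℚ_[p] K L]
          rfl
        rw [Algebra.smul_def, e]
        refine mul_mem (hOm _ ?_) hx
        rw [← IsScalarTower.algebraMap_apply ℚ_[p] K L, hν]
        exact c.norm_le_one }
  have key : ∀ k : ℕ, ∀ x, ν x ≤ 1 → ∃ m ∈ Algebra.adjoin O {ϖ}, ∃ y, ν y ≤ 1 ∧ x = m + ϖ ^ k * y := by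
    intro k
    induction k with
    | zero => intro x hx; exact ⟨0, zero_mem _, x, hx, by simp⟩
    | succ k ih =>
      intro x hx
      obtain ⟨m, hm, y, hy, e⟩ := ih x hx
      obtain ⟨a, ha⟩ := hres y hy
      have ha1 : ν (algebraMap K L a) ≤ 1 := by
        have := core_sub ν hna _ _ _ hy ha.le
        simpa using this
      refine ⟨m + ϖ ^ k * algebraMap K L a, add_mem hm (mul_mem (pow_mem 
        (Algebra.subset_adjoin (by simp)) _) (hOm a ha1)), (y - algebraMap K L a) / ϖ, ?_, ?_⟩
      · rw [map_div₀]
        exact div_le_one_of_le₀ (hmax _ ha) hϖ00.le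
      · rw [e]; field_simp; ring
  suffices h : coreO ν hna hν ≤ M from h hx
  refine Submodule.le_of_le_smul_of_le_jacobson_bot (I := Ideal.span {(p : ℤ_[p])}) 
    (coreO_fg ν hna hν) ?_ ?_
  · rw [← PadicInt.maximalIdeal_eq_span_p]
    exact IsLocalRing.maximalIdeal_le_jacobson _
  · intro x hx
    obtain ⟨k, hk⟩ := exists_pow_lt_of_lt_one hνp0 hϖ
    obtain ⟨m, hm, y, hy, e⟩ := key k x hx
    rw [e]
    refine Submodule.add_mem_sup hm ?_
    have e2 : ϖ ^ k * y = (p : ℤ_[p]) • (ϖ ^ k * y / p) := by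
      rw [Algebra.smul_def, map_natCast]; field_simp
    rw [e2]
    refine Submodule.smul_mem_smul (Ideal.mem_span_singleton_self _) ?_
    change ν _ ≤ 1
    rw [map_div₀, map_mul, map_pow]
    refine div_le_one_of_le₀ ?_ hνp0.le
    calc _ ≤ ν ϖ ^ k * 1 := by gcongr
      _ ≤ _ := by linarith

open Polynomial in
theorem core_deriv [FiniteDimensional K L] [IsGalois K L] [DecidableEq (L ≃ₐ[K] L)] (ϖ : L)
    (hgen : Algebra.adjoin K {ϖ} = ⊤) :
    aeval ϖ (derivative (minpoly K ϖ)) = 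
      ∏ σ ∈ (Finset.univ : Finset (L ≃ₐ[K] L)).erase 1, (ϖ - σ ϖ) := by
  classical
  have hi : IsIntegral K ϖ := Algebra.IsIntegral.isIntegral ϖ
  have hinj : Function.Injective (fun σ : L ≃ₐ[K] L => σ ϖ) := by
    intro σ τ h
    have h2 : (σ : L →ₐ[K] L) = τ := by
      apply AlgHom.ext_of_adjoin_eq_top hgen
      intro x hx
      rw [Set.mem_singleton_iff] at hx
      subst hx
      exact h
    ext x
    exact DFunLike.congr_fun h2 x
  have hfin : (minpoly K ϖ).natDegree = Module.finrank K L := by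
    have e : IntermediateField.adjoin K {ϖ} = ⊤ := by
      rw [← top_le_iff]
      intro x _
      have : x ∈ Algebra.adjoin K {ϖ} := by rw [hgen]; trivial
      exact IntermediateField.algebra_adjoin_le_adjoin K _ this
    rw [← IntermediateField.adjoin.finrank hi, e, IntermediateField.finrank_top']
  have hprod : (minpoly K ϖ).map (algebraMap K L) = ∏ σ : L ≃ₐ[K] L, (X - C (σ ϖ)) := by
    apply Polynomial.eq_of_monic_of_dvd_of_natDegree_le
    · exact monic_prod_of_monic _ _ fun σ _ => monic_X_sub_C _
    · exact (minpoly.monic hi).map _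
    · apply Finset.prod_dvd_of_coprime
      · intro σ _ τ _ h
        exact isCoprime_X_sub_C_of_isUnit_sub (isUnit_iff_ne_zero.2 (sub_ne_zero.2 (fun e => h (hinj e))))
      · intro σ _
        rw [dvd_iff_isRoot, IsRoot, eval_map_algebraMap, aeval_algHom_apply, minpoly.aeval, map_zero]
    · rw [natDegree_map, hfin, natDegree_prod_of_monic _ _ fun σ _ => monic_X_sub_C _]
      simp [← Nat.card_eq_fintype_card, IsGalois.card_aut_eq_finrank]
  rw [← eval_map_algebraMap, ← derivative_map, hprod, derivative_prod_finset]
  rw [eval_finsetSum, Finset.sum_eq_single 1]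
  · simp [eval_prod]
  · intro σ _ hσ
    simp only [derivative_X_sub_C, mul_one, eval_prod]
    apply Finset.prod_eq_zero (i := 1)
    · simp [hσ.symm]
    · simp
  · simp

theorem core_trace [Algebra ℚ_[p] K] [Algebra ℚ_[p] L] [IsScalarTower ℚ_[p] K L]
    [FiniteDimensional ℚ_[p] L] [Algebra ℤ_[p] L]
    [IsScalarTower ℤ_[p] ℚ_[p] L] [FiniteDimensional K L] [IsGalois K L] [DecidableEq (L ≃ₐ[K] L)]
    (ν : AbsoluteValue L ℝ) (hna : IsNonarchimedean ν)
    (hν : ∀ c : ℚ_[p], ν (algebraMap ℚ_[p] L c) = ‖c‖) (ϖ : L) (hϖ0 : ϖ ≠ 0) (hϖ : ν ϖ < 1)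
    (hmax : ∀ y, ν y < 1 → ν y ≤ ν ϖ)
    (hinv : ∀ (σ : L ≃ₐ[K] L) x, ν (σ x) = ν x)
    (htot : ∀ (σ : L ≃ₐ[K] L) x, ν x ≤ 1 → ν (σ x - x) ≤ ν ϖ)
    (z : L) (hz : ν z * ∏ σ ∈ (Finset.univ : Finset (L ≃ₐ[K] L)).erase 1, ν (σ ϖ - ϖ) ≤ 1) :
    ν (algebraMap K L (Algebra.trace K L z)) ≤ 1 := by
  have hp2 : 2 ≤ p := (Fact.out : p.Prime).two_le
  have : CharZero L := charZero_of_injective_algebraMap (algebraMap ℚ_[p] L).injective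
  have hp0 : (p : L) ≠ 0 := by exact_mod_cast (by omega : p ≠ 0)
  have hνp : ν (p : L) < 1 := by
    have := hν p
    rw [map_natCast] at this
    rw [this]; exact Padic.norm_p_lt_one
  have hres := core_residue (K := K) ν hna hν ϖ hϖ hinv htot
  have hna' : IsNonarchimedean (ν.comp (algebraMap K L).injective) := fun a b => by
    change ν (algebraMap K L (a + b)) ≤ _
    rw [map_add]
    exact hna _ _
  set O : ValuationSubring K := coreV (ν.comp (algebraMap K L).injective) hna' with hOdef
  have hO : ∀ x : K, x ∈ O ↔ ν (algebraMap K L x) ≤ 1 := fun x => Iff.rfl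
  have hgenO := core_gen (p := p) ν hna hν ϖ hϖ0 hϖ hmax hres O hO
  have hle : ∀ x ∈ Algebra.adjoin O {ϖ}, x ∈ Algebra.adjoin K {ϖ} := by
    intro x hx
    have : Algebra.adjoin O {ϖ} ≤ (Algebra.adjoin K {ϖ}).restrictScalars O := 
      Algebra.adjoin_le (by simp)
    exact this hx
  have hgen : Algebra.adjoin K {ϖ} = ⊤ := by
    rw [← top_le_iff]
    intro x _
    obtain ⟨k, hk⟩ : ∃ k : ℕ, ν (p : L) ^ k * ν x < 1 := by
      obtain ⟨k, hk⟩ := exists_pow_lt_of_lt_one (show 0 < (ν x + 1)⁻¹ by have := ν.nonneg x; positivity) hνp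
      refine ⟨k, ?_⟩
      have := ν.nonneg x
      calc _ ≤ (ν x + 1)⁻¹ * ν x := by gcongr
        _ < 1 := by rw [inv_mul_lt_one₀ (by positivity)]; linarith
    have h2 := hle _ (hgenO ((p : L) ^ k * x) (by rw [map_mul, map_pow]; exact hk.le))
    have e : x = ((p : K) ^ k)⁻¹ • ((p : L) ^ k * x) := by
      rw [Algebra.smul_def]; simp; field_simp
    rw [e]
    exact Subalgebra.smul_mem _ h2 _
  have hint : IsIntegral O ϖ := by
    have h1 := core_integral ν hν ϖ hϖ.le
    obtain ⟨q, hq, hq2⟩ := h1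
    let g : ℤ_[p] →+* O := ((algebraMap ℚ_[p] K).comp (algebraMap ℤ_[p] ℚ_[p])).codRestrict O (by
      intro c
      rw [hO]
      simp only [RingHom.comp_apply]
      rw [← IsScalarTower.algebraMap_apply ℚ_[p] K L, hν]
      exact c.norm_le_one)
    refine ⟨q.map g, hq.map _, ?_⟩
    rw [Polynomial.eval₂_map]
    convert hq2
    ext c
    rw [IsScalarTower.algebraMap_apply ℤ_[p] ℚ_[p] L, IsScalarTower.algebraMap_apply ℚ_[p] K L]
    rfl
  have hdual := traceForm_dualSubmodule_adjoin O K hgen hint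
  have hD := core_deriv ϖ hgen
  set D := Polynomial.aeval ϖ (Polynomial.derivative (minpoly K ϖ)) with hDdef
  have hD0 : D ≠ 0 := by
    have hs : (minpoly K ϖ).Separable := Algebra.IsSeparable.isSeparable K ϖ
    exact hs.aeval_derivative_ne_zero (minpoly.aeval K ϖ)
  have hmem : z ∈ (Algebra.traceForm K L).dualSubmodule 
      (Subalgebra.toSubmodule (Algebra.adjoin O {ϖ})) := by
    rw [hdual]
    rw [Submodule.mem_smul_pointwise_iff_exists]
    refine ⟨D * z, hgenO _ ?_, ?_⟩
    · rw [map_mul, hD, map_prod, mul_comm]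
      refine le_trans (le_of_eq ?_) hz
      congr 1
      exact Finset.prod_congr rfl fun σ _ => ν.map_sub _ _
    · simp [smul_eq_mul, hD0]
  rw [LinearMap.BilinForm.mem_dualSubmodule] at hmem
  have h1 := hmem 1 (one_mem (Algebra.adjoin O {ϖ}))
  rw [Algebra.traceForm_apply, mul_one, Submodule.mem_one] at h1
  obtain ⟨y, hy⟩ := h1
  rw [← hy]
  exact y.2
end core4
section herb

theorem herb_main {G : Type} [Finite G] [One G] (S : ℤ → Set G) (hS : Antitone S)
    (h1 : ∀ i, 1 ∈ S i) (φ : ℝ → ℝ)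
    (hφ : ∀ u, φ u = ∫ t in (0:ℝ)..u, (Nat.card ↥(S ⌈t⌉) : ℝ) / (Nat.card ↥(S 0) : ℝ)) (n : ℕ) :
    Function.invFun φ 0 = 0 ∧ ∃ T : ℕ, ⌈Function.invFun φ (n : ℝ)⌉ = (T : ℤ) ∧
      n * Nat.card ↥(S 0) ≤ ∑ i ∈ Finset.range T, Nat.card ↥(S ((i : ℤ) + 1)) := by
  set N : ℝ := (Nat.card ↥(S 0) : ℝ) with hN
  have hpos : ∀ i, 1 ≤ Nat.card ↥(S i) := fun i => by
    have : Nonempty ↥(S i) := ⟨⟨1, h1 i⟩⟩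
    exact Nat.card_pos
  have hN0 : 0 < N := by rw [hN]; exact_mod_cast hpos 0
  set g : ℝ → ℝ := fun t => (Nat.card ↥(S ⌈t⌉) : ℝ) / N with hg
  have hanti : Antitone g := by
    intro a b hab
    simp only [hg]
    gcongr
    exact Nat.card_mono (Set.toFinite _) (hS (Int.ceil_mono hab))
  have hlow : ∀ t, 1 / N ≤ g t := by
    intro t
    simp only [hg]
    gcongr
    exact_mod_cast hpos _
  have hint : ∀ a b, IntervalIntegrable g MeasureTheory.volume a b := fun a b =>
    hanti.intervalIntegrable
  have hdiff : ∀ a b, a ≤ b → (b - a) / N ≤ φ b - φ a := by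
    intro a b hab
    rw [hφ, hφ, intervalIntegral.integral_interval_sub_left (hint _ _) (hint _ _)]
    calc (b - a) / N = ∫ t in a..b, 1 / N := by simp [div_eq_mul_inv]
      _ ≤ _ := intervalIntegral.integral_mono_on hab (by simp) (hint _ _) fun t _ => hlow t
  have hmono : StrictMono φ := by
    intro a b hab
    have := hdiff a b hab.le
    have h2 : 0 < (b - a) / N := div_pos (by linarith) hN0
    linarith
  have hφ0 : φ 0 = 0 := by rw [hφ]; simp
  have hcont : Continuous φ := by
    have : φ = fun u => ∫ t in (0:ℝ)..u, g t := funext hφ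
    rw [this]
    exact intervalIntegral.continuous_primitive hint 0
  have hsurj : Function.Surjective φ := by
    apply hcont.surjective
    · refine Filter.tendsto_atTop_mono' _ ?_ (Filter.tendsto_id.atTop_div_const hN0)
      filter_upwards [Filter.eventually_ge_atTop 0] with u hu
      have := hdiff 0 u hu
      simpa [hφ0] using this
    · refine Filter.tendsto_atBot_mono' _ ?_ (Filter.tendsto_id.atBot_div_const hN0)
      filter_upwards [Filter.eventually_le_atBot 0] with u hu
      have := hdiff u 0 hu
      simp only [hφ0, zero_sub, neg_div] at this
      simp only [id]
      linarith
  have hinv : ∀ w, φ (Function.invFun φ w) = w := fun w => Function.invFun_eq (hsurj w)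
  refine ⟨hmono.injective (by rw [hinv, hφ0]), ?_⟩
  have hψ : 0 ≤ Function.invFun φ (n : ℝ) := by
    rw [← hmono.le_iff_le, hinv, hφ0]; positivity
  refine ⟨⌈Function.invFun φ (n : ℝ)⌉₊, (Int.natCast_ceil_eq_ceil hψ).symm, ?_⟩
  have hsum : ∀ T : ℕ, φ T = (∑ i ∈ Finset.range T, (Nat.card ↥(S ((i : ℤ) + 1)) : ℝ)) / N := by
    intro T
    induction T with
    | zero => simp [hφ0]
    | succ T ih =>
      have : φ ((T + 1 : ℕ) : ℝ) - φ T = (Nat.card ↥(S ((T : ℤ) + 1)) : ℝ) / N := by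
        rw [hφ, hφ, intervalIntegral.integral_interval_sub_left (hint _ _) (hint _ _)]
        have e : ∫ t in (T : ℝ)..((T + 1 : ℕ) : ℝ), g t = 
            ∫ t in (T : ℝ)..((T + 1 : ℕ) : ℝ), (Nat.card ↥(S ((T : ℤ) + 1)) : ℝ) / N := by
          apply intervalIntegral.integral_congr_ae
          refine Filter.Eventually.of_forall fun t ht => ?_
          rw [Set.uIoc_of_le (by push_cast; linarith)] at ht
          have : ⌈t⌉ = (T : ℤ) + 1 := by
            rw [Int.ceil_eq_iff]
            have h1 := ht.1
            have h2 := ht.2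
            push_cast at h2 ⊢
            constructor <;> linarith
          simp only [hg, this]
        rw [e]
        simp
      rw [Finset.sum_range_succ, add_div, ← ih, ← this]
      ring
  have h2 : (n : ℝ) ≤ φ ⌈Function.invFun φ (n : ℝ)⌉₊ := by
    rw [← hinv n, hmono.le_iff_le, hinv]
    exact Nat.le_ceil _
  rw [hsum, le_div_iff₀ hN0, hN] at h2
  exact_mod_cast h2

theorem count_main {G : Type} [Fintype G] [DecidableEq G] [One G] (S : ℤ → Set G)
    (h1 : ∀ i, 1 ∈ S i) (a : G → ℝ) (r : ℝ) (hr0 : 0 ≤ r) (hr1 : r ≤ 1) (ha0 : ∀ g, 0 ≤ a g)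
    (ha1 : ∀ g, a g ≤ 1)
    (ha : ∀ g, ∀ i : ℕ, g ∈ S i → a g ≤ r ^ (i + 1)) (y : ℝ) (T : ℕ) (hy : y ≤ r ^ (T + 1)) :
    y * ∏ g ∈ Finset.univ.erase (1 : G), a g ≤ 
      r ^ (∑ i ∈ Finset.range (T + 1), Nat.card ↥(S (i : ℤ))) := by
  classical
  let c : G → ℕ := fun g => ((Finset.range (T + 1)).filter fun i : ℕ => g ∈ S i).card
  have hc1 : c 1 = T + 1 := by simp [c, h1]
  have hsum : ∑ i ∈ Finset.range (T + 1), Nat.card ↥(S (i : ℤ)) = ∑ g, c g := by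
    simp only [c, Finset.card_filter]
    rw [Finset.sum_comm]
    refine Finset.sum_congr rfl fun i _ => ?_
    rw [← Finset.card_filter, Nat.card_eq_fintype_card, Fintype.card_subtype]
  have hac : ∀ g, a g ≤ r ^ c g := by
    intro g
    rcases Finset.eq_empty_or_nonempty ((Finset.range (T + 1)).filter fun i : ℕ => g ∈ S i) with h | h
    · simp only [c, h]; simpa using ha1 g
    · set m := Finset.max' _ h with hm
      have hmem := Finset.max'_mem _ h
      rw [← hm, Finset.mem_filter] at hmem
      refine (ha g m hmem.2).trans (pow_le_pow_of_le_one hr0 hr1 ?_)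
      have : ((Finset.range (T + 1)).filter fun i : ℕ => g ∈ S i) ⊆ Finset.range (m + 1) := by
        intro i hi
        rw [Finset.mem_range]
        have := Finset.le_max' _ i hi
        omega
      simpa using Finset.card_le_card this
  rw [hsum, ← Finset.add_sum_erase _ _ (Finset.mem_univ (1 : G)), hc1, pow_add,
    ← Finset.prod_pow_eq_pow_sum]
  apply mul_le_mul hy
  · exact Finset.prod_le_prod (fun g _ => ha0 g) fun g _ => hac g
  · exact Finset.prod_nonneg fun g _ => ha0 g
  · positivity
end herb

section conv
variable {p : ℕ} {A : Type} [Field A]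

theorem conv_one (vd : PadicValData A p) : vd.v 1 = 0 := by
  have h := vd.v_mul 1 1
  have hne : vd.v 1 ≠ ⊤ := fun h => one_ne_zero ((vd.v_top_iff 1).1 h)
  obtain ⟨q, hq⟩ := WithTop.ne_top_iff_exists.1 hne
  rw [mul_one, ← hq] at h
  rw [← hq]
  norm_cast at h ⊢
  linarith

/-- the real-valued size of an extended valuation -/
noncomputable def convSize (p : ℕ) : WithTop ℚ → ℝ
  | ⊤ => 0
  | (q : ℚ) => (p : ℝ) ^ (-(q : ℝ))

theorem convSize_le (hp : 1 < p) (a b : WithTop ℚ) : convSize p a ≤ convSize p b ↔ b ≤ a := by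
  have h1 : (1 : ℝ) < p := by exact_mod_cast hp
  have hpos : ∀ x : ℝ, 0 < (p : ℝ) ^ x := fun x => Real.rpow_pos_of_pos (by linarith) x
  induction a using WithTop.recTopCoe with
  | top =>
    induction b using WithTop.recTopCoe with
    | top => simp
    | coe b => simp [convSize, (hpos _).le]
  | coe a =>
    induction b using WithTop.recTopCoe with
    | top => simpa [convSize] using hpos _
    | coe b => simp [convSize, Real.rpow_le_rpow_left_iff h1]

theorem convSize_add (hp : 1 < p) (a b : WithTop ℚ) :
    convSize p (a + b) = convSize p a * convSize p b := by
  have h1 : (1 : ℝ) < p := by exact_mod_cast hp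
  induction a using WithTop.recTopCoe with
  | top => simp [convSize]
  | coe a =>
    induction b using WithTop.recTopCoe with
    | top => simp [convSize]
    | coe b =>
      rw [← WithTop.coe_add]
      simp only [convSize]
      rw [← Real.rpow_add (by linarith)]
      push_cast
      ring_nf

theorem convSize_nonneg (a : WithTop ℚ) : 0 ≤ convSize p a := by
  induction a using WithTop.recTopCoe with
  | top => simp [convSize]
  | coe a => simp only [convSize]; positivity

theorem convSize_zero : convSize p 0 = 1 := by
  change convSize p ((0 : ℚ) : WithTop ℚ) = 1
  simp [convSize]

theorem convSize_na (vd : PadicValData A p) (hp : 1 < p) (x y : A) :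
    convSize p (vd.v (x + y)) ≤ max (convSize p (vd.v x)) (convSize p (vd.v y)) := by
  have := vd.v_min_le_add x y
  rw [min_le_iff] at this
  rw [le_max_iff, convSize_le hp, convSize_le hp]
  exact this

/-- the absolute value attached to the valuation -/
noncomputable def convAbs (vd : PadicValData A p) (hp : 1 < p) : AbsoluteValue A ℝ where
  toFun x := convSize p (vd.v x)
  map_mul' x y := by rw [vd.v_mul, convSize_add hp]
  nonneg' x := convSize_nonneg _
  eq_zero' x := by
    have hpos : ∀ x : ℝ, 0 < (p : ℝ) ^ x := fun x => Real.rpow_pos_of_pos (by positivity) x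
    rw [← vd.v_top_iff]
    generalize vd.v x = a
    induction a using WithTop.recTopCoe with
    | top => simp [convSize]
    | coe a => simp [convSize, (hpos _).ne']
  add_le' x y := (convSize_na vd hp x y).trans 
    (max_le_add_of_nonneg (convSize_nonneg _) (convSize_nonneg _))

theorem convAbs_le_one (vd : PadicValData A p) (hp : 1 < p) (x : A) :
    convAbs vd hp x ≤ 1 ↔ 0 ≤ vd.v x := by
  rw [← convSize_zero (p := p)]; exact convSize_le hp _ _

theorem convAbs_lt_one (vd : PadicValData A p) (hp : 1 < p) (x : A) :
    convAbs vd hp x < 1 ↔ 0 < vd.v x := by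
  rw [← not_le, ← not_le, ← convSize_zero (p := p)]
  exact not_congr (convSize_le hp _ _)

theorem convAbs_le (vd : PadicValData A p) (hp : 1 < p) (x y : A) :
    convAbs vd hp x ≤ convAbs vd hp y ↔ vd.v y ≤ vd.v x := convSize_le hp _ _

theorem convAbs_p (vd : PadicValData A p) (hp : 1 < p) : convAbs vd hp (p : A) = (p : ℝ)⁻¹ := by
  change convSize p (vd.v p) = _
  rw [vd.v_coe_p]
  change convSize p ((1 : ℚ) : WithTop ℚ) = _
  simp [convSize, Real.rpow_neg_one]

theorem pow_succ_sub (vd : PadicValData A p) {F : Type} [Field F] (emb : F →+* A) (j : ℕ) (y : A)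
    (h : InMaxIdealPow vd emb (j + 1) y) : InMaxIdealPow vd emb j y := by
  obtain ⟨u, s, hu, hs, e⟩ := h
  refine ⟨u * s 0, fun k => s k.succ, ?_, fun k => hs _, ?_⟩
  · rw [map_mul, vd.v_mul]; exact add_nonneg hu (hs 0).le
  · rw [e, Fin.prod_univ_succ, map_mul, mul_assoc]

theorem pow_anti (vd : PadicValData A p) {F : Type} [Field F] (emb : F →+* A) {i j : ℕ}
    (hij : i ≤ j) (y : A)
    (h : InMaxIdealPow vd emb j y) : InMaxIdealPow vd emb i y := by
  induction hij with
  | refl => exact h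
  | step _ ih => exact ih (pow_succ_sub _ _ _ _ h)

theorem pow_bound (vd : PadicValData A p) (hp : 1 < p) {F : Type} [Field F] (emb : F →+* A)
    (ϖ : F) (hmax : ∀ y, convAbs vd hp (emb y) < 1 → convAbs vd hp (emb y) ≤ convAbs vd hp (emb ϖ))
    (j : ℕ) (y : A)
    (h : InMaxIdealPow vd emb j y) : convAbs vd hp y ≤ convAbs vd hp (emb ϖ) ^ j := by
  obtain ⟨u, s, hu, hs, e⟩ := h
  rw [e, map_mul, map_prod]
  calc _ ≤ 1 * ∏ k : Fin j, convAbs vd hp (emb ϖ) := by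
        apply mul_le_mul
        · rwa [convAbs_le_one]
        · refine Finset.prod_le_prod (fun k _ => AbsoluteValue.nonneg _ _) fun k _ => ?_
          apply hmax
          rw [convAbs_lt_one]; exact hs k
        · exact Finset.prod_nonneg fun k _ => AbsoluteValue.nonneg _ _
        · norm_num
    _ = _ := by simp

theorem lower_anti (vd : PadicValData A p) (K L : Type) [Field K] [Field L] [Algebra K L]
    (emb : L →+* A) : Antitone (lowerRamSet vd K L emb) := by
  intro i j hij σ hσ x hx
  exact pow_anti vd emb (Int.toNat_le_toNat (by omega)) _ (hσ x hx)

theorem lower_one (vd : PadicValData A p) (K L : Type) [Field K] [Field L] [Algebra K L]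
    (emb : L →+* A) (i : ℤ) : 1 ∈ lowerRamSet vd K L emb i := by
  intro x hx
  refine ⟨0, fun _ => 0, ?_, ?_, ?_⟩
  · rw [map_zero, (vd.v_top_iff 0).2 rfl]; exact le_top
  · intro k; rw [map_zero, (vd.v_top_iff 0).2 rfl]; exact WithTop.coe_lt_top _
  · simp
end conv

section

/-- Lemma 2.5. Let `L/K` satisfy condition (ram) with parameter `n`.
Then for every `σ` in the upper ramification group `G^n` and all `α, β ∈ O_L`, the trace
`Tr_{L/K}((σα − α)·β)` lies in `m_K^{n+1}`, the `(n+1)`-st power of the maximal ideal of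
`O_K`. -/
theorem statement3 {p : ℕ} [Fact p.Prime] (hp : Odd p)
    {A : Type} [Field A] (vd : PadicValData A p)
    (K L : Type) [Field K] [Field L]
    [Algebra ℚ_[p] K] [FiniteDimensional ℚ_[p] K]
    [Algebra K L] [FiniteDimensional K L] [IsGalois K L]
    (emb : L →+* A)
    (hab : ∀ σ τ : L ≃ₐ[K] L, σ * τ = τ * σ)
    (π : K) (hπ : IsUniformizer vd (emb.comp (algebraMap K L)) π)
    (n : ℕ) (hram : RamCond vd K L emb n)
    (σ : L ≃ₐ[K] L) (hσ : σ ∈ upperRamSet vd K L emb (n : ℤ))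
    (α β : L) (hα : 0 ≤ vd.v (emb α)) (hβ : 0 ≤ vd.v (emb β)) :
    InMaxIdealPow vd (emb.comp (algebraMap K L)) (n + 1)
      ((emb.comp (algebraMap K L)) (Algebra.trace K L ((σ α - α) * β))) := by
  classical
  have hp1 : 1 < p := (Fact.out : p.Prime).one_lt
  letI : Algebra ℚ_[p] L := ((algebraMap K L).comp (algebraMap ℚ_[p] K)).toAlgebra
  haveI : IsScalarTower ℚ_[p] K L := IsScalarTower.of_algebraMap_eq fun _ => rfl
  letI : Algebra ℤ_[p] L := ((algebraMap ℚ_[p] L).comp (algebraMap ℤ_[p] ℚ_[p])).toAlgebra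
  haveI : IsScalarTower ℤ_[p] ℚ_[p] L := IsScalarTower.of_algebraMap_eq fun _ => rfl
  haveI : FiniteDimensional ℚ_[p] L := Module.Finite.trans K L
  set ν : AbsoluteValue L ℝ := (convAbs vd hp1).comp emb.injective with hνdef
  have hνe : ∀ x, ν x = convAbs vd hp1 (emb x) := fun x => rfl
  have hna : IsNonarchimedean ν := fun x y => by
    rw [hνe, map_add]; exact convSize_na vd hp1 _ _
  obtain ⟨hπ0, hπpos, hπmin⟩ := hπ
  have hπ1 : ν (algebraMap K L π) < 1 := (convAbs_lt_one vd hp1 _).2 hπpos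
  have hπmin' : ∀ y : K, ν (algebraMap K L y) < 1 →
      ν (algebraMap K L y) ≤ ν (algebraMap K L π) := fun y hy =>
    (convAbs_le vd hp1 _ _).2 (hπmin y ((convAbs_lt_one vd hp1 _).1 hy))
  have hν : ∀ c : ℚ_[p], ν (algebraMap ℚ_[p] L c) = ‖c‖ := by
    intro c
    refine core_padic (ν.comp (algebraMap K L).injective) π hπ0 hπ1 hπmin' ?_ c
    change convAbs vd hp1 (emb (algebraMap K L (p : K))) = _
    rw [map_natCast, map_natCast, convAbs_p]
  have hinv : ∀ (τ : L ≃ₐ[K] L) x, ν (τ x) = ν x := fun τ x =>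
    core_inv ν hν (τ.restrictScalars ℚ_[p]) x
  obtain ⟨ϖ, hϖ0, hϖ1, hmax, hϖN⟩ := core_unif ν hinv π hπ0 hπ1 hπmin'
  have hbound := pow_bound vd hp1 emb ϖ hmax
  set S := lowerRamSet vd K L emb with hS
  obtain ⟨hψ0, T, hT, hsum⟩ := herb_main S (lower_anti vd K L emb) (lower_one vd K L emb)
    (herbrandPhi vd K L emb) (fun u => rfl) n
  have hS0 : S 0 = Set.univ := by
    have h := hram.2.1
    rw [upperRamSet, herbrandPsi, Int.cast_zero, hψ0, Int.ceil_zero] at h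
    exact h
  have hσT : σ ∈ S (T : ℤ) := by
    rw [upperRamSet, herbrandPsi, Int.cast_natCast, hT] at hσ
    exact hσ
  have hlow : ∀ (τ : L ≃ₐ[K] L) (i : ℕ), τ ∈ S (i : ℤ) → ∀ x, ν x ≤ 1 →
      ν (τ x - x) ≤ ν ϖ ^ (i + 1) := by
    intro τ i hτ x hx
    have h := hbound _ _ (hτ x ((convAbs_le_one vd hp1 _).1 hx))
    rw [← map_sub, show ((i : ℤ) + 1).toNat = i + 1 by omega] at h
    exact h
  have htot : ∀ (τ : L ≃ₐ[K] L) x, ν x ≤ 1 → ν (τ x - x) ≤ ν ϖ := by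
    intro τ x hx
    have h := hlow τ 0 (by rw [Nat.cast_zero, hS0]; trivial) x hx
    simpa using h
  have hα' : ν α ≤ 1 := (convAbs_le_one vd hp1 _).2 hα
  have hβ' : ν β ≤ 1 := (convAbs_le_one vd hp1 _).2 hβ
  have hy : ν ((σ α - α) * β) ≤ ν ϖ ^ (T + 1) := by
    rw [map_mul]
    exact (mul_le_of_le_one_right (ν.nonneg _) hβ').trans (hlow σ T hσT α hα')
  have hcount := count_main S (lower_one vd K L emb) (fun τ => ν (τ ϖ - ϖ)) (ν ϖ) (ν.nonneg _)
    hϖ1.le (fun τ => ν.nonneg _) (fun τ => (htot τ ϖ hϖ1.le).trans hϖ1.le)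
    (fun τ i hτ => hlow τ i hτ ϖ hϖ1.le) _ T hy
  have hcard : Nat.card (L ≃ₐ[K] L) * (n + 1) ≤
      ∑ i ∈ Finset.range (T + 1), Nat.card ↥(S (i : ℤ)) := by
    rw [Finset.sum_range_succ']
    push_cast
    have e : Nat.card ↥(S 0) = Nat.card (L ≃ₐ[K] L) := by
      rw [hS0]; exact Nat.card_congr (Equiv.Set.univ _)
    rw [e] at hsum ⊢
    linarith
  have hπL : algebraMap K L π ≠ 0 := by simpa using hπ0
  have hρ0 : 0 < ν (algebraMap K L π) := ν.pos hπL
  have hfinal : ν ((σ α - α) * β) * ∏ τ ∈ (Finset.univ : Finset (L ≃ₐ[K] L)).erase 1, ν (τ ϖ - ϖ)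
      ≤ ν (algebraMap K L π) ^ (n + 1) := by
    refine hcount.trans ((pow_le_pow_of_le_one (ν.nonneg _) hϖ1.le hcard).trans ?_)
    rw [pow_mul]
    exact pow_le_pow_left₀ (pow_nonneg (ν.nonneg _) _) hϖN _
  have htr := core_trace (K := K) ν hna hν ϖ hϖ0 hϖ1 hmax hinv htot
    ((π ^ (n + 1))⁻¹ • ((σ α - α) * β)) (by
      rw [Algebra.smul_def, map_mul, map_inv₀, map_inv₀, map_pow, map_pow, mul_assoc,
        inv_mul_le_one₀ (by positivity)]
      exact hfinal)
  refine ⟨Algebra.trace K L ((π ^ (n + 1))⁻¹ • ((σ α - α) * β)), fun _ => π,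
    (convAbs_le_one vd hp1 _).1 htr, fun _ => hπpos, ?_⟩
  rw [Finset.prod_const, Finset.card_univ, Fintype.card_fin, ← map_pow, ← map_mul, map_smul,
    smul_eq_mul]
  congr 1
  field_simp

end
end

section
/- Let L/K satisfy condition (ram) with parameter n, and let χ be a character of G = Gal(L/K) of conductor p^{n+1}. Then for all α, β ∈ O_L, the product of local resolvents satisfies ⟨α|χ⟩·⟨β|χ^{-1}⟩ = Σ_{γ∈G} Tr_{L/K}(α^γ β)·χ(γ) ≡ 0 mod π^{n+1}. -/
namespace PadicValData

section basic

variable {p : ℕ} {A : Type} [Field A] (vd : PadicValData A p)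

theorem v_zero : vd.v 0 = ⊤ := (vd.v_top_iff 0).2 rfl

theorem exists_rat {x : A} (hx : x ≠ 0) : ∃ q : ℚ, vd.v x = (q : WithTop ℚ) := by
  have h : vd.v x ≠ ⊤ := fun h => hx ((vd.v_top_iff x).1 h)
  exact ⟨(vd.v x).untop h, (WithTop.coe_untop _ h).symm⟩

theorem v_one : vd.v 1 = 0 := by
  obtain ⟨q, hq⟩ := vd.exists_rat (one_ne_zero (α := A))
  have h := vd.v_mul 1 1
  rw [mul_one, hq] at h
  rw [hq]
  have h' : q = q + q := by exact_mod_cast h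
  have : q = 0 := by linarith
  rw [this]; rfl

theorem v_pow (x : A) (n : ℕ) : vd.v (x ^ n) = n • vd.v x := by
  induction n with
  | zero => simp [vd.v_one]
  | succ k ih => rw [pow_succ, vd.v_mul, ih, succ_nsmul]

theorem v_neg_one : vd.v (-1) = 0 := by
  obtain ⟨q, hq⟩ := vd.exists_rat (x := (-1 : A)) (by simp)
  have h := vd.v_mul (-1) (-1)
  rw [neg_one_mul, neg_neg, hq, vd.v_one] at h
  rw [hq]
  have h' : 0 = q + q := by exact_mod_cast h
  have : q = 0 := by linarith
  rw [this]; rfl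

theorem v_neg (x : A) : vd.v (-x) = vd.v x := by
  rw [← neg_one_mul, vd.v_mul, vd.v_neg_one, zero_add]

theorem le_v_add {c : WithTop ℚ} {x y : A} (hx : c ≤ vd.v x) (hy : c ≤ vd.v y) :
    c ≤ vd.v (x + y) := le_trans (le_min hx hy) (vd.v_min_le_add x y)

theorem le_v_sub {c : WithTop ℚ} {x y : A} (hx : c ≤ vd.v x) (hy : c ≤ vd.v y) :
    c ≤ vd.v (x - y) := by
  rw [sub_eq_add_neg]; exact vd.le_v_add hx (by rwa [vd.v_neg])

theorem lt_v_add {c : WithTop ℚ} {x y : A} (hx : c < vd.v x) (hy : c < vd.v y) :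
    c < vd.v (x + y) := lt_of_lt_of_le (lt_min hx hy) (vd.v_min_le_add x y)

theorem lt_v_sub {c : WithTop ℚ} {x y : A} (hx : c < vd.v x) (hy : c < vd.v y) :
    c < vd.v (x - y) := by
  rw [sub_eq_add_neg]; exact vd.lt_v_add hx (by rwa [vd.v_neg])

theorem le_v_sum {ι : Type*} {c : WithTop ℚ} (s : Finset ι) (f : ι → A)
    (h : ∀ i ∈ s, c ≤ vd.v (f i)) : c ≤ vd.v (∑ i ∈ s, f i) := by
  classical
  induction s using Finset.induction_on with
  | empty => simp [vd.v_zero]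
  | insert a s ha ih =>
    rw [Finset.sum_insert ha]
    exact vd.le_v_add (h a (by simp)) (ih fun i hi => h i (by simp [hi]))

theorem lt_v_sum {ι : Type*} {c : WithTop ℚ} (hc : c < ⊤) (s : Finset ι) (f : ι → A)
    (h : ∀ i ∈ s, c < vd.v (f i)) : c < vd.v (∑ i ∈ s, f i) := by
  classical
  induction s using Finset.induction_on with
  | empty => simpa [vd.v_zero] using hc
  | insert a s ha ih =>
    rw [Finset.sum_insert ha]
    exact vd.lt_v_add (h a (by simp)) (ih fun i hi => h i (by simp [hi]))

theorem v_prod {ι : Type*} (s : Finset ι) (f : ι → A) :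
    vd.v (∏ i ∈ s, f i) = ∑ i ∈ s, vd.v (f i) := by
  classical
  induction s using Finset.induction_on with
  | empty => simp [vd.v_one]
  | insert a s ha ih => rw [Finset.prod_insert ha, Finset.sum_insert ha, vd.v_mul, ih]

theorem v_natCast_nonneg (n : ℕ) : 0 ≤ vd.v (n : A) := by
  induction n with
  | zero => simp [vd.v_zero]
  | succ k ih => rw [Nat.cast_succ]; exact vd.le_v_add ih vd.v_one.ge

theorem v_inv_coe {x : A} {q : ℚ} (h : vd.v x = q) : vd.v x⁻¹ = ((-q : ℚ) : WithTop ℚ) := by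
  have hx : x ≠ 0 := by rintro rfl; rw [vd.v_zero] at h; exact WithTop.top_ne_coe h
  obtain ⟨r, hr⟩ := vd.exists_rat (inv_ne_zero hx)
  have := vd.v_mul x x⁻¹
  rw [mul_inv_cancel₀ hx, vd.v_one, h, hr] at this
  have h' : 0 = q + r := by exact_mod_cast this
  rw [hr, show r = -q by linarith]

theorem p_ne_zero (vd : PadicValData A p) : (p : A) ≠ 0 := by
  intro h
  have := vd.v_coe_p
  rw [h, vd.v_zero] at this
  exact absurd this (by decide)

theorem v_pow_coe {x : A} {q : ℚ} (h : vd.v x = q) (n : ℕ) :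
    vd.v (x ^ n) = ((n * q : ℚ) : WithTop ℚ) := by
  rw [vd.v_pow, h, ← nsmul_eq_mul]; rfl

theorem v_natCast_of_not_dvd [Fact p.Prime] {c : ℕ} (hc : ¬ p ∣ c) : vd.v (c : A) = 0 := by
  refine le_antisymm ?_ (vd.v_natCast_nonneg c)
  by_contra! hlt
  have hcop : IsCoprime (p : ℤ) (c : ℤ) :=
    Nat.isCoprime_iff_coprime.2 ((Nat.Prime.coprime_iff_not_dvd Fact.out).2 hc)
  obtain ⟨a, b, hab⟩ := hcop
  have hint : ∀ z : ℤ, 0 ≤ vd.v (z : A) := by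
    intro z
    obtain ⟨m, rfl | rfl⟩ := z.eq_nat_or_neg
    · simpa using vd.v_natCast_nonneg m
    · simpa [vd.v_neg] using vd.v_natCast_nonneg m
  have h1 : (a : A) * p + b * c = 1 := by exact_mod_cast congrArg (Int.cast : ℤ → A) hab
  have : 0 < vd.v ((a : A) * p + b * c) := by
    apply vd.lt_v_add
    · rw [vd.v_mul, vd.v_coe_p]
      exact lt_of_lt_of_le (by norm_num) (add_le_add_left (hint a) 1)
    · rw [vd.v_mul]
      exact lt_of_lt_of_le hlt (by simpa using add_le_add_left (hint b) (vd.v (c : A)))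
  rw [h1, vd.v_one] at this
  exact lt_irrefl _ this

/-- Pull back of a valuation along a ring hom. -/
def comap {F : Type} [Field F] (f : F →+* A) : PadicValData F p where
  v x := vd.v (f x)
  v_top_iff x := by rw [vd.v_top_iff, map_eq_zero]
  v_mul x y := by rw [map_mul, vd.v_mul]
  v_min_le_add x y := by rw [map_add]; exact vd.v_min_le_add _ _
  v_coe_p := by rw [map_natCast, vd.v_coe_p]

theorem nonneg_or_inv (x : A) : 0 ≤ vd.v x ∨ 0 ≤ vd.v x⁻¹ := by
  by_cases hx : x = 0
  · left; simp [hx, vd.v_zero]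
  · obtain ⟨q, hq⟩ := vd.exists_rat hx
    rw [vd.v_inv_coe hq, hq]
    rcases le_total 0 q with h | h
    · left; exact_mod_cast h
    · right
      have : 0 ≤ -q := by linarith
      exact_mod_cast this

/-- The valuation ring. -/
def O : ValuationSubring A where
  carrier := {x | 0 ≤ vd.v x}
  mul_mem' {a b} ha hb := by
    simp only [Set.mem_ofPred_eq] at *
    rw [vd.v_mul]; exact add_nonneg ha hb
  one_mem' := vd.v_one.ge
  add_mem' ha hb := vd.le_v_add ha hb
  zero_mem' := by simp [vd.v_zero]
  neg_mem' {a} ha := by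
    simp only [Set.mem_ofPred_eq] at *
    rwa [vd.v_neg]
  mem_or_inv_mem' := vd.nonneg_or_inv

theorem mem_O {x : A} : x ∈ vd.O ↔ 0 ≤ vd.v x := Iff.rfl

theorem mem_max {x : vd.O} : x ∈ IsLocalRing.maximalIdeal vd.O ↔ 0 < vd.v (x : A) := by
  rw [IsLocalRing.mem_maximalIdeal, mem_nonunits_iff]
  by_cases hx0 : (x : A) = 0
  · have hx' : x = 0 := Subtype.ext hx0
    subst hx'
    simp [vd.v_zero]
  obtain ⟨q, hq⟩ := vd.exists_rat hx0
  have h0 : 0 ≤ vd.v (x : A) := x.2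
  constructor
  · intro h
    refine lt_of_le_of_ne h0 fun he => h ?_
    have h2 : (x : A)⁻¹ ∈ vd.O := by
      rw [mem_O, vd.v_inv_coe hq]
      rw [hq] at he
      have : 0 = q := by exact_mod_cast he
      rw [← this]; simp
    exact IsUnit.of_mul_eq_one ⟨_, h2⟩ (Subtype.ext (mul_inv_cancel₀ hx0))
  · rintro h ⟨u, hu⟩
    have h3 : vd.v ((x : A) * ((u⁻¹ : vd.Oˣ) : vd.O)) = 0 := by
      have : (x : A) * ((u⁻¹ : vd.Oˣ) : vd.O) = 1 := by
        rw [← hu]; exact congrArg Subtype.val (Units.mul_inv u)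
      rw [this, vd.v_one]
    have h4 : 0 ≤ vd.v (((u⁻¹ : vd.Oˣ) : vd.O) : A) := (((u⁻¹ : vd.Oˣ) : vd.O)).2
    rw [vd.v_mul] at h3
    have : 0 < vd.v (x : A) + vd.v (((u⁻¹ : vd.Oˣ) : vd.O) : A) := add_pos_of_pos_of_nonneg h h4
    rw [h3] at this
    exact lt_irrefl _ this

end basic

/-- values of p-adic integers are nonnegative, if the value group is discrete. -/
theorem padicInt_nonneg {p : ℕ} [Fact p.Prime] {K : Type} [Field K] [Algebra ℚ_[p] K]
    (w : PadicValData K p) (q0 : ℚ) (hq0 : 0 < q0) (hmin : ∀ y : K, 0 < w.v y → (q0 : WithTop ℚ) ≤ w.v y)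
    (x : ℤ_[p]) : 0 ≤ w.v (algebraMap ℚ_[p] K x) := by
  set g : ℤ_[p] → K := fun x => algebraMap ℚ_[p] K x with hg
  have gadd : ∀ a b, g (a + b) = g a + g b := fun a b => by simp [hg]
  have gmul : ∀ a b, g (a * b) = g a * g b := fun a b => by simp [hg]
  have gp : g (p : ℤ_[p]) = p := by simp [hg]
  have gpow : ∀ a (k : ℕ), g (a ^ k) = g a ^ k := fun a b => by simp [hg]
  have key : ∀ k : ℕ, ∀ y : ℤ_[p], ‖y‖ < 1 → w.v (g y) < 0 →
      w.v (g y) ≤ ((-(2 ^ k * q0) : ℚ) : WithTop ℚ) := by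
    intro k
    induction k with
    | zero =>
      intro y hy hneg
      have h0 : g y ≠ 0 := by
        intro h; rw [h, w.v_zero] at hneg; exact absurd hneg (by simp)
      obtain ⟨q, hq⟩ := w.exists_rat h0
      rw [hq] at hneg ⊢
      have hn : q < 0 := by exact_mod_cast hneg
      have h1 := hmin (g y)⁻¹ (by
        rw [w.v_inv_coe hq]; have : 0 < -q := by linarith
        exact_mod_cast this)
      rw [w.v_inv_coe hq] at h1
      have h2 : q0 ≤ -q := by exact_mod_cast h1
      have h3 : q ≤ -(2 ^ 0 * q0) := by simp; linarith
      exact_mod_cast h3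
    | succ k ih =>
      intro y hy hneg
      obtain ⟨z, hz, hz1, -, -⟩ := hensels_lemma (p := p) (R := ℤ_[p])
        (F := Polynomial.X ^ 2 + Polynomial.X - Polynomial.C y) (a := 0) (by simpa using hy)
      have hz2 : z ^ 2 + z = y := by
        simp at hz; linear_combination hz
      have hz3 : ‖z‖ < 1 := by simpa using hz1
      have hy' : g y = g z * (g z + 1) := by
        rw [← hz2, gadd, gpow]; ring
      have hzneg : w.v (g z) < 0 := by
        by_contra! hcon
        rw [hy', w.v_mul] at hneg
        exact absurd hneg (not_lt.2 (add_nonneg hcon (w.le_v_add hcon w.v_one.ge)))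
      have hz4 := ih z hz3 hzneg
      have h0 : g z ≠ 0 := by
        intro h; rw [h, w.v_zero] at hzneg; exact absurd hzneg (by simp)
      obtain ⟨q, hq⟩ := w.exists_rat h0
      have h5 : w.v (g z + 1) ≤ q := by
        by_contra! hcon
        have := w.lt_v_sub hcon (y := 1) (by rw [w.v_one, ← hq]; exact hzneg)
        rw [add_sub_cancel_right, hq] at this
        exact lt_irrefl _ this
      rw [hq] at hz4
      have hz6 : q ≤ -(2 ^ k * q0) := by exact_mod_cast hz4
      rw [hy', w.v_mul, hq]
      calc (q : WithTop ℚ) + w.v (g z + 1) ≤ q + q := by gcongr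
        _ = ((q + q : ℚ) : WithTop ℚ) := rfl
        _ ≤ _ := by
          have : q + q ≤ -(2 ^ (k + 1) * q0) := by rw [pow_succ]; linarith
          exact_mod_cast this
  have key2 : ∀ y : ℤ_[p], ‖y‖ < 1 → 0 ≤ w.v (g y) := by
    intro y hy
    by_contra! hneg
    have h0 : g y ≠ 0 := by
      intro h; rw [h, w.v_zero] at hneg; exact absurd hneg (by simp)
    obtain ⟨q, hq⟩ := w.exists_rat h0
    obtain ⟨k, hk⟩ := pow_unbounded_of_one_lt (-q / q0) (one_lt_two (α := ℚ))
    have := key k y hy hneg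
    rw [hq] at this
    have h1 : q ≤ -(2 ^ k * q0) := by exact_mod_cast this
    rw [div_lt_iff₀ hq0] at hk
    linarith
  by_contra! hneg
  have h0 : g x ≠ 0 := by
    intro h; change w.v (g x) < 0 at hneg; rw [h, w.v_zero] at hneg; exact absurd hneg (by simp)
  obtain ⟨q, hq⟩ := w.exists_rat h0
  change w.v (g x) < 0 at hneg
  rw [hq] at hneg
  have hn : q < 0 := by exact_mod_cast hneg
  obtain ⟨k, hk⟩ := exists_nat_gt (1 / (-q))
  rw [div_lt_iff₀ (by linarith)] at hk
  have h1 := key2 (p * x ^ k) (by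
    rw [norm_mul, PadicInt.norm_p]
    have hp1 : (1 : ℝ) < p := by exact_mod_cast (Fact.out : p.Prime).one_lt
    calc (p : ℝ)⁻¹ * ‖x ^ k‖ ≤ (p : ℝ)⁻¹ * 1 := by gcongr; exact PadicInt.norm_le_one _
      _ < 1 := by rw [mul_one]; exact inv_lt_one_of_one_lt₀ hp1)
  rw [gmul, gpow, gp, w.v_mul, w.v_coe_p, w.v_pow_coe hq] at h1
  have h2 : 0 ≤ 1 + k * q := by exact_mod_cast h1
  linarith

end PadicValData

namespace PadicValData

theorem exists_frob_pow {p : ℕ} [Fact p.Prime] {L : Type} [Field L] (w : PadicValData L p)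
    (f : ℤ_[p] →+* w.O) (x : L) (hx : 0 ≤ w.v x)
    (P : Polynomial ℤ_[p]) (hP : P ≠ 0) (hPx : P.eval₂ (w.O.subtype.comp f) x = 0) :
    ∃ m : ℕ, 1 ≤ m ∧ 0 < w.v (x ^ p ^ m - x) := by
  classical
  let : NormalizedGCDMonoid ℤ_[p] := Classical.choice inferInstance
  set Q := P.primPart with hQ
  have hQprim : Q.IsPrimitive := P.isPrimitive_primPart
  have hinj : Function.Injective (w.O.subtype.comp f) := by
    rw [injective_iff_map_eq_zero]
    intro z hz
    by_contra hz0
    obtain ⟨u, hu⟩ : ∃ u : ℤ_[p]ˣ, z = u * (p : ℤ_[p]) ^ z.valuation :=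
      ⟨_, PadicInt.unitCoeff_spec hz0⟩
    rw [hu, map_mul, map_pow, map_natCast, mul_eq_zero] at hz
    rcases hz with hz | hz
    · have : IsUnit (w.O.subtype.comp f (u : ℤ_[p])) := u.isUnit.map _
      exact this.ne_zero hz
    · exact w.p_ne_zero (eq_zero_of_pow_eq_zero hz)
  have hQx : Q.eval₂ (w.O.subtype.comp f) x = 0 :=
    Polynomial.eval₂_primPart_eq_zero hinj hP hPx
  let k := IsLocalRing.ResidueField w.O
  let r : w.O →+* k := IsLocalRing.residue w.O
  let x' : w.O := ⟨x, hx⟩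
  have hr : ∀ y : w.O, r y = 0 ↔ 0 < w.v (y : L) := fun y => by
    rw [← w.mem_max]; exact IsLocalRing.residue_eq_zero_iff y
  have hp0 : (p : k) = 0 := by
    have : r (p : w.O) = 0 := (hr _).2 (by
      have : ((p : w.O) : L) = p := by simp
      rw [this, w.v_coe_p]; norm_num)
    simpa using this
  have : CharP k p := ringChar.of_eq (CharP.ringChar_of_prime_eq_zero Fact.out hp0)
  let : Algebra (ZMod p) k := ZMod.algebra k p
  have hfac : (algebraMap (ZMod p) k).comp PadicInt.toZMod = r.comp f := by
    ext z
    have h1 := PadicInt.sub_zmodRepr_mem z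
    rw [PadicInt.maximalIdeal_eq_span_p, Ideal.mem_span_singleton] at h1
    obtain ⟨t, ht⟩ := h1
    have h2 : z = (p : ℤ_[p]) * t + z.zmodRepr := by rw [← ht]; ring
    rw [h2]
    simp [hp0]
  have hQ0 : Q.map (PadicInt.toZMod) ≠ 0 := by
    intro h0
    have h1 : Polynomial.C (p : ℤ_[p]) ∣ Q := by
      rw [Polynomial.C_dvd_iff_dvd_coeff]
      intro i
      have h2 := congrArg (fun q => Polynomial.coeff q i) h0
      simp only [Polynomial.coeff_map, Polynomial.coeff_zero] at h2
      rw [← RingHom.mem_ker, PadicInt.ker_toZMod, PadicInt.maximalIdeal_eq_span_p,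
        Ideal.mem_span_singleton] at h2
      exact h2
    exact PadicInt.prime_p.not_isUnit (hQprim _ h1)
  have hroot : Polynomial.aeval (r x') (Q.map (PadicInt.toZMod)) = 0 := by
    rw [Polynomial.aeval_def, Polynomial.eval₂_map, hfac, ← Polynomial.hom_eval₂]
    have : Q.eval₂ f x' = 0 := by
      apply Subtype.val_injective
      have := Polynomial.hom_eval₂ Q f w.O.subtype x'
      exact this.trans hQx
    rw [this, map_zero]
  have hint : IsIntegral (ZMod p) (r x') :=
    (show IsAlgebraic (ZMod p) (r x') from ⟨_, hQ0, hroot⟩).isIntegral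
  have hfin : Module.Finite (ZMod p) (Algebra.adjoin (ZMod p) {r x'}) :=
    ⟨(Submodule.fg_top _).2 hint.fg_adjoin_singleton⟩
  have : Finite (Algebra.adjoin (ZMod p) {r x'}) := Module.finite_of_finite (ZMod p)
  obtain ⟨i, j, hij, he⟩ := Finite.exists_ne_map_eq_of_infinite
    (fun i : ℕ => (⟨r x', Algebra.self_mem_adjoin_singleton _ _⟩ :
      Algebra.adjoin (ZMod p) {r x'}) ^ p ^ i)
  have he' : r x' ^ p ^ i = r x' ^ p ^ j := congrArg Subtype.val he
  have main : ∀ i j : ℕ, i < j → r x' ^ p ^ i = r x' ^ p ^ j →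
      ∃ m : ℕ, 1 ≤ m ∧ 0 < w.v (x ^ p ^ m - x) := by
    intro i j hij he
    refine ⟨j - i, by omega, ?_⟩
    have h1 : (r x' ^ p ^ (j - i)) ^ p ^ i = r x' ^ p ^ i := by
      rw [← pow_mul, ← pow_add, Nat.sub_add_cancel hij.le, he]
    have h2 : r x' ^ p ^ (j - i) = r x' := by
      have h3 : (r x' ^ p ^ (j - i) - r x') ^ p ^ i = 0 := by
        rw [sub_pow_char_pow, h1, sub_self]
      exact sub_eq_zero.1 (pow_eq_zero_iff (pow_ne_zero _ (Fact.out : p.Prime).ne_zero) |>.1 h3)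
    have h4 : r (x' ^ p ^ (j - i) - x') = 0 := by rw [map_sub, map_pow, h2, sub_self]
    exact (hr _).1 h4
  rcases lt_or_gt_of_ne hij with h | h
  · exact main i j h he'
  · exact main j i h he'.symm

theorem not_dvd_choose {p : ℕ} [Fact p.Prime] (s m : ℕ) (hm : ¬ p ∣ m) :
    ¬ p ∣ (p ^ s * m).choose (p ^ s) := by
  induction s with
  | zero => simpa using hm
  | succ s ih =>
    have hp : 0 < p := (Fact.out : p.Prime).pos
    have h := Choose.choose_modEq_choose_mod_mul_choose_div_nat (n := p ^ (s+1) * m)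
      (k := p ^ (s + 1)) (p := p)
    have e1 : p ^ (s+1) * m % p = 0 := by
      rw [pow_succ']; simp [Nat.mul_assoc]
    have e2 : p ^ (s+1) % p = 0 := by rw [pow_succ']; simp
    have e3 : p ^ (s+1) * m / p = p ^ s * m := by
      rw [pow_succ', Nat.mul_assoc, Nat.mul_div_cancel_left _ hp]
    have e4 : p ^ (s+1) / p = p ^ s := by
      rw [pow_succ', Nat.mul_div_cancel_left _ hp]
    rw [e1, e2, e3, e4] at h
    simp only [Nat.choose_self, one_mul] at h
    rw [(Nat.ModEq.dvd_iff h dvd_rfl)]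
    exact ih

theorem v_prod_sub_pos {p : ℕ} {L : Type} [Field L] (w : PadicValData L p) {ι : Type*}
    (s : Finset ι) (f : ι → L) (x : L) (hx : 0 ≤ w.v x) (hf : ∀ i, 0 < w.v (f i - x)) :
    0 < w.v (∏ i ∈ s, f i - x ^ s.card) := by
  classical
  induction s using Finset.induction_on with
  | empty => simp [w.v_zero]
  | insert a s ha ih =>
    rw [Finset.prod_insert ha, Finset.card_insert_of_notMem ha]
    have e : f a * ∏ i ∈ s, f i - x ^ (s.card + 1)
      = f a * (∏ i ∈ s, f i - x ^ s.card) + (f a - x) * x ^ s.card := by ring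
    rw [e]
    have hfa : 0 ≤ w.v (f a) := by
      have := w.le_v_add (hf a).le hx
      simpa using this
    apply w.lt_v_add
    · rw [w.v_mul]; exact Right.add_pos_of_nonneg_of_pos hfa ih
    · rw [w.v_mul]; exact add_pos_of_pos_of_nonneg (hf a) (by rw [w.v_pow]; exact nsmul_nonneg hx _)

theorem v_pow_sub_pos {p : ℕ} {L : Type} [Field L] (w : PadicValData L p)
    (x y : L) (hx : 0 ≤ w.v x) (h : 0 < w.v (y - x)) (k : ℕ) : 0 < w.v (y ^ k - x ^ k) := by
  have := w.v_prod_sub_pos (Finset.range k) (fun _ => y) x hx (fun _ => h)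
  simpa using this

theorem approx {p : ℕ} [Fact p.Prime] {K L : Type} [Field K] [Field L] [Algebra K L]
    [FiniteDimensional K L] [IsGalois K L]
    [Algebra ℚ_[p] K] [FiniteDimensional ℚ_[p] K] (w : PadicValData L p)
    (hunr : ∀ (σ : L ≃ₐ[K] L) (x : L), 0 ≤ w.v x → 0 < w.v (σ x - x))
    (hZ : ∀ x : ℤ_[p], 0 ≤ w.v (algebraMap K L (algebraMap ℚ_[p] K x)))
    (x : L) (hx : 0 ≤ w.v x) :
    ∃ y : K, 0 ≤ w.v (algebraMap K L y) ∧ 0 < w.v (x - algebraMap K L y) := by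
  classical
  -- step a
  have ha : ∃ m : ℕ, 1 ≤ m ∧ 0 < w.v (x ^ p ^ m - x) := by
    let g : ℤ_[p] →+* L := (algebraMap K L).comp ((algebraMap ℚ_[p] K).comp PadicInt.Coe.ringHom)
    let f : ℤ_[p] →+* w.O := g.codRestrict w.O.toSubring (fun z => hZ z)
    let : Algebra ℚ_[p] L := ((algebraMap K L).comp (algebraMap ℚ_[p] K)).toAlgebra
    have : IsScalarTower ℚ_[p] K L := IsScalarTower.of_algebraMap_eq (fun _ => rfl)
    have : FiniteDimensional ℚ_[p] L := FiniteDimensional.trans ℚ_[p] K L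
    let : Algebra ℤ_[p] L := g.toAlgebra
    have : IsScalarTower ℤ_[p] ℚ_[p] L := IsScalarTower.of_algebraMap_eq (fun _ => rfl)
    have halg : IsAlgebraic ℚ_[p] x := Algebra.IsAlgebraic.isAlgebraic x
    have halg' : IsAlgebraic ℤ_[p] x := (IsFractionRing.isAlgebraic_iff ℤ_[p] ℚ_[p] L).2 halg
    obtain ⟨P, hP, hPx⟩ := halg'
    exact w.exists_frob_pow f x hx P hP hPx
  -- step b
  obtain ⟨s, m, hm, hN⟩ := Nat.exists_eq_pow_mul_and_not_dvd
    (n := Fintype.card (L ≃ₐ[K] L)) Fintype.card_ne_zero p (Fact.out : p.Prime).ne_one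
  have hb : ∃ y : K, 0 ≤ w.v (algebraMap K L y) ∧ 0 < w.v (x ^ p ^ s - algebraMap K L y) := by
    let E : L := ∑ T ∈ Finset.powersetCard (p ^ s) (Finset.univ : Finset (L ≃ₐ[K] L)),
      ∏ σ ∈ T, σ x
    have hE : E = MvPolynomial.aeval (fun σ : L ≃ₐ[K] L => σ x)
        (MvPolynomial.esymm (L ≃ₐ[K] L) K (p ^ s)) := by
      simp [E, MvPolynomial.esymm]
    have hfix : ∀ g : L ≃ₐ[K] L, g E = E := by
      intro g
      have h1 := MvPolynomial.rename_esymm (L ≃ₐ[K] L) K (p ^ s) (Equiv.mulLeft g)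
      nth_rw 2 [hE]
      rw [← h1, MvPolynomial.aeval_rename]
      simp [E, MvPolynomial.esymm]
    obtain ⟨e, he⟩ := (IsGalois.mem_range_algebraMap_iff_fixed E).2 hfix
    set c : ℕ := (Fintype.card (L ≃ₐ[K] L)).choose (p ^ s) with hc
    have hcv : w.v (c : L) = 0 := by
      apply w.v_natCast_of_not_dvd
      rw [hc, hN]
      exact not_dvd_choose s m hm
    have hEx : 0 < w.v (E - c * x ^ p ^ s) := by
      have : E - c * x ^ p ^ s = ∑ T ∈ Finset.powersetCard (p ^ s)
          (Finset.univ : Finset (L ≃ₐ[K] L)), (∏ σ ∈ T, σ x - x ^ p ^ s) := by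
        rw [Finset.sum_sub_distrib, Finset.sum_const, Finset.card_powersetCard,
          Finset.card_univ, nsmul_eq_mul]
      rw [this]
      apply w.lt_v_sum (by exact WithTop.coe_lt_top 0)
      intro T hT
      rw [← (Finset.mem_powersetCard.1 hT).2]
      exact w.v_prod_sub_pos T (fun σ => σ x) x hx (fun σ => hunr σ x hx)
    have hc0 : (c : L) ≠ 0 := by
      intro h; rw [h, w.v_zero] at hcv; exact absurd hcv (by simp)
    have hci : w.v (c : L)⁻¹ = 0 := by
      rw [w.v_inv_coe (q := 0) (by simpa using hcv)]; simp
    have hcK : algebraMap K L (e * (c : K)⁻¹) = E * (c : L)⁻¹ := by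
      rw [map_mul, he, map_inv₀, map_natCast]
    have hd : 0 < w.v (x ^ p ^ s - algebraMap K L (e * (c : K)⁻¹)) := by
      have : x ^ p ^ s - algebraMap K L (e * (c : K)⁻¹) = -((E - c * x ^ p ^ s) * (c : L)⁻¹) := by
        rw [hcK]; field_simp; ring
      rw [this, w.v_neg, w.v_mul, hci, add_zero]
      exact hEx
    refine ⟨e * (c : K)⁻¹, ?_, hd⟩
    have := w.le_v_sub (c := 0) (x := x ^ p ^ s) (by rw [w.v_pow]; exact nsmul_nonneg hx _) hd.le
    simpa using this
  obtain ⟨m, hm1, hmx⟩ := ha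
  obtain ⟨y, hy0, hy⟩ := hb
  have hiter : ∀ k : ℕ, 0 < w.v (x ^ p ^ (m * k) - x) := by
    intro k
    induction k with
    | zero => simp [w.v_zero]
    | succ k ih =>
      have h1 := w.v_pow_sub_pos x _ hx hmx (p ^ (m * k))
      have h2 := w.lt_v_add h1 ih
      rw [← pow_mul, ← pow_add] at h2
      rw [Nat.mul_succ, Nat.add_comm]
      simpa using h2
  refine ⟨y ^ p ^ (m * s - s), by rw [map_pow, w.v_pow]; exact nsmul_nonneg hy0 _, ?_⟩
  have h1 := w.v_pow_sub_pos (algebraMap K L y) _ hy0 hy (p ^ (m * s - s))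
  have hle : s ≤ m * s := Nat.le_mul_of_pos_left s hm1
  rw [← pow_mul, ← pow_add, Nat.add_sub_cancel' hle] at h1
  have h2 := w.lt_v_sub h1 (hiter s)
  rw [map_pow]
  convert h2 using 2
  ring

end PadicValData

namespace PadicValData

section galois

variable {p : ℕ} {K L : Type} [Field K] [Field L] [Algebra K L]

theorem v_le_aut (w : PadicValData L p)
    (hunr : ∀ (σ : L ≃ₐ[K] L) (x : L), 0 ≤ w.v x → 0 < w.v (σ x - x))
    (σ : L ≃ₐ[K] L) (x : L) : w.v x ≤ w.v (σ x) := by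
  have hnn : ∀ y : L, 0 ≤ w.v y → 0 ≤ w.v (σ y) := by
    intro y hy
    have := w.le_v_add (hunr σ y hy).le hy
    simpa using this
  by_cases hx : x = 0
  · simp [hx]
  obtain ⟨q, hq⟩ := w.exists_rat hx
  obtain ⟨r, hr⟩ := w.exists_rat (x := σ x) (by simpa using hx)
  have hp1 : w.v (p : L) = ((1 : ℚ) : WithTop ℚ) := w.v_coe_p
  have hqd : (q.den : ℚ) * q = q.num := by rw [mul_comm]; exact Rat.mul_den_eq_num q
  have hden : (0 : ℚ) < q.den := by exact_mod_cast q.den_pos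
  rw [hq, hr]
  obtain ⟨a, ha | ha⟩ := q.num.eq_nat_or_neg
  · have h1 := hnn (x ^ q.den * ((p : L) ^ a)⁻¹) (by
      rw [w.v_mul, w.v_pow_coe hq, w.v_inv_coe (w.v_pow_coe hp1 a)]
      have : 0 ≤ q.den * q + -(a * 1) := by rw [hqd, ha]; simp
      exact_mod_cast this)
    rw [map_mul, map_inv₀, map_pow, map_pow, map_natCast, w.v_mul, w.v_pow_coe hr,
      w.v_inv_coe (w.v_pow_coe hp1 a)] at h1
    have h2 : 0 ≤ q.den * r + -(a * 1) := by exact_mod_cast h1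
    have h3 : (q.den : ℚ) * q ≤ q.den * r := by
      rw [hqd, ha]; push_cast; linarith
    exact_mod_cast le_of_mul_le_mul_left h3 hden
  · have h1 := hnn (x ^ q.den * ((p : L) ^ a)) (by
      rw [w.v_mul, w.v_pow_coe hq, w.v_pow_coe hp1 a]
      have : 0 ≤ q.den * q + (a * 1) := by rw [hqd, ha]; simp
      exact_mod_cast this)
    rw [map_mul, map_pow, map_pow, map_natCast, w.v_mul, w.v_pow_coe hr,
      w.v_pow_coe hp1 a] at h1
    have h2 : 0 ≤ q.den * r + (a * 1) := by exact_mod_cast h1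
    have h3 : (q.den : ℚ) * q ≤ q.den * r := by
      rw [hqd, ha]; push_cast; linarith
    exact_mod_cast le_of_mul_le_mul_left h3 hden

theorem v_aut (w : PadicValData L p)
    (hunr : ∀ (σ : L ≃ₐ[K] L) (x : L), 0 ≤ w.v x → 0 < w.v (σ x - x))
    (σ : L ≃ₐ[K] L) (x : L) : w.v (σ x) = w.v x := by
  refine le_antisymm ?_ (w.v_le_aut hunr σ x)
  simpa using w.v_le_aut hunr σ.symm (σ x)

variable [FiniteDimensional K L] [IsGalois K L]

theorem v_norm (w : PadicValData L p)
    (hunr : ∀ (σ : L ≃ₐ[K] L) (x : L), 0 ≤ w.v x → 0 < w.v (σ x - x))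
    (x : L) : w.v (algebraMap K L (Algebra.norm K x)) = Nat.card (L ≃ₐ[K] L) • w.v x := by
  rw [Algebra.norm_eq_prod_automorphisms, w.v_prod, Finset.sum_congr rfl
    (fun σ _ => w.v_aut hunr σ x), Finset.sum_const, Finset.card_univ, Nat.card_eq_fintype_card]

theorem v_trace_nonneg (w : PadicValData L p)
    (hunr : ∀ (σ : L ≃ₐ[K] L) (x : L), 0 ≤ w.v x → 0 < w.v (σ x - x))
    (x : L) (hx : 0 ≤ w.v x) : 0 ≤ w.v (algebraMap K L (Algebra.trace K L x)) := by
  rw [trace_eq_sum_automorphisms]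
  exact w.le_v_sum _ _ fun σ _ => by rwa [w.v_aut hunr σ x]

/-- discreteness -/
theorem exists_int_mul (w : PadicValData K p) (π : K) (q0 : ℚ) (hq0 : 0 < q0)
    (hπ : w.v π = q0) (hmin : ∀ y : K, 0 < w.v y → (q0 : WithTop ℚ) ≤ w.v y)
    (y : K) (hy : 0 < w.v y) (hy0 : y ≠ 0) : ∃ k : ℕ, 1 ≤ k ∧ w.v y = ((k * q0 : ℚ) : WithTop ℚ) := by
  obtain ⟨q, hq⟩ := w.exists_rat hy0
  rw [hq] at hy
  have hqpos : 0 < q := by exact_mod_cast hy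
  set k := ⌊q / q0⌋₊ with hk
  have h1 : (k : ℚ) ≤ q / q0 := Nat.floor_le (by positivity)
  have h2 : q / q0 < k + 1 := Nat.lt_floor_add_one _
  rw [le_div_iff₀ hq0] at h1
  rw [div_lt_iff₀ hq0] at h2
  have hv : w.v (y * (π ^ k)⁻¹) = ((q + -(k * q0) : ℚ) : WithTop ℚ) := by
    rw [w.v_mul, w.v_inv_coe (w.v_pow_coe hπ k), hq]; rfl
  have h3 : q = k * q0 := by
    by_contra hne
    have hlt : 0 < q + -(k * q0) := by
      have := lt_of_le_of_ne h1 (Ne.symm hne)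
      linarith
    have := hmin _ (by rw [hv]; exact_mod_cast hlt)
    rw [hv] at this
    have h4 : q0 ≤ q + -(k * q0) := by exact_mod_cast this
    linarith
  refine ⟨k, ?_, by rw [hq, h3]⟩
  rcases Nat.eq_zero_or_pos k with h0 | h0
  · rw [h0] at h3; simp at h3; linarith
  · exact h0

theorem exists_unif (w : PadicValData L p)
    (hunr : ∀ (σ : L ≃ₐ[K] L) (x : L), 0 ≤ w.v x → 0 < w.v (σ x - x))
    (π : K) (q0 : ℚ) (hq0 : 0 < q0) (hπ : w.v (algebraMap K L π) = q0)
    (hmin : ∀ y : K, 0 < w.v (algebraMap K L y) → (q0 : WithTop ℚ) ≤ w.v (algebraMap K L y)) :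
    ∃ (P : L) (q1 : ℚ), 0 < q1 ∧ w.v P = q1 ∧ (∀ y : L, 0 < w.v y → (q1 : WithTop ℚ) ≤ w.v y) ∧
      q0 ≤ Nat.card (L ≃ₐ[K] L) * q1 := by
  classical
  set N := Nat.card (L ≃ₐ[K] L) with hN
  have hNpos : 0 < N := Nat.card_pos
  have hNq : (0 : ℚ) < N := by exact_mod_cast hNpos
  have key : ∀ (y : L) (q : ℚ), w.v y = q → 0 < q → ∃ k : ℕ, 1 ≤ k ∧ (N : ℚ) * q = k * q0 := by
    intro y q hq hqpos
    have h1 := w.v_norm hunr y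
    rw [← hN, ← w.v_pow, w.v_pow_coe hq] at h1
    have hpos : (0 : ℚ) < N * q := by positivity
    have hne : Algebra.norm K y ≠ 0 := by
      intro h
      rw [h, map_zero, w.v_zero] at h1
      exact WithTop.top_ne_coe h1
    obtain ⟨k, hk1, hk⟩ := exists_int_mul (w.comap (algebraMap K L)) π q0 hq0 hπ hmin
      (Algebra.norm K y) (by
        change 0 < w.v _
        rw [h1]; exact_mod_cast hpos) hne
    refine ⟨k, hk1, ?_⟩
    have h2 : ((N * q : ℚ) : WithTop ℚ) = ((k * q0 : ℚ) : WithTop ℚ) := h1.symm.trans hk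
    exact_mod_cast h2
  have hex : ∃ k : ℕ, ∃ (y : L) (q : ℚ), w.v y = q ∧ 0 < q ∧ (N : ℚ) * q = k * q0 := by
    obtain ⟨k, -, hk⟩ := key _ q0 hπ hq0
    exact ⟨k, _, q0, hπ, hq0, hk⟩
  obtain ⟨P, q1, hP, hq1, hk⟩ := Nat.find_spec hex
  refine ⟨P, q1, hq1, hP, ?_, ?_⟩
  · intro y hy
    by_cases hy0 : y = 0
    · simp [hy0, w.v_zero]
    obtain ⟨q, hq⟩ := w.exists_rat hy0
    rw [hq] at hy ⊢
    have hqpos : 0 < q := by exact_mod_cast hy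
    obtain ⟨k, hk1, hk2⟩ := key y q hq hqpos
    have hle : Nat.find hex ≤ k := Nat.find_min' hex ⟨y, q, hq, hqpos, hk2⟩
    have hle' : (Nat.find hex : ℚ) ≤ k := by exact_mod_cast hle
    have : (N : ℚ) * q1 ≤ N * q := by rw [hk, hk2]; gcongr
    exact_mod_cast le_of_mul_le_mul_left this hNq
  · obtain ⟨k, hk1, hk2⟩ := key P q1 hP hq1
    rw [hk2]
    have : (1 : ℚ) ≤ k := by exact_mod_cast hk1
    nlinarith

theorem trace_bound (w : PadicValData L p)
    (hunr : ∀ (σ : L ≃ₐ[K] L) (x : L), 0 ≤ w.v x → 0 < w.v (σ x - x))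
    (happ : ∀ x : L, 0 ≤ w.v x →
      ∃ y : K, 0 ≤ w.v (algebraMap K L y) ∧ 0 < w.v (x - algebraMap K L y))
    (P : L) (q1 : ℚ) (hq1 : 0 < q1) (hP : w.v P = q1)
    (hmin : ∀ y : L, 0 < w.v y → (q1 : WithTop ℚ) ≤ w.v y)
    (t : K) (ht : t ≠ 0) (z : L)
    (hz : ∀ D : L, (∀ r : (L ≃ₐ[K] L) → ℕ,
        (∀ σ : L ≃ₐ[K] L, σ ≠ 1 → ((r σ * q1 : ℚ) : WithTop ℚ) ≤ w.v (σ P - P)) →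
        (((∑ᶠ σ ∈ {σ : L ≃ₐ[K] L | σ ≠ 1}, r σ : ℕ) * q1 : ℚ) : WithTop ℚ) ≤ w.v D) →
        w.v (algebraMap K L t) ≤ w.v z + w.v D) :
    w.v (algebraMap K L t) ≤ w.v (algebraMap K L (Algebra.trace K L z)) := by
  classical
  let R := (w.comap (algebraMap K L)).O
  have hR : ∀ y : K, y ∈ R ↔ 0 ≤ w.v (algebraMap K L y) := fun y => Iff.rfl
  let M : Subalgebra R L := Algebra.adjoin R {P}
  have hPM : P ∈ M := Algebra.self_mem_adjoin_singleton R P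
  have hP0 : P ≠ 0 := by
    rintro rfl; rw [w.v_zero] at hP; exact WithTop.top_ne_coe hP
  have happM : ∀ m : ℕ, ∀ x : L, 0 ≤ w.v x → ∃ y ∈ M, ((m * q1 : ℚ) : WithTop ℚ) ≤ w.v (x - y) := by
    intro m
    induction m with
    | zero => intro x hx; exact ⟨0, M.zero_mem, by simpa using hx⟩
    | succ m ih =>
      intro x hx
      obtain ⟨y, hy0, hy⟩ := happ x hx
      have h1 := hmin _ hy
      obtain ⟨y', hy'M, hy'⟩ := ih ((x - algebraMap K L y) * P⁻¹) (by
        rw [w.v_mul, w.v_inv_coe hP]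
        calc (0 : WithTop ℚ) = ((q1 + -q1 : ℚ) : WithTop ℚ) := by simp
          _ = (q1 : WithTop ℚ) + ((-q1 : ℚ) : WithTop ℚ) := rfl
          _ ≤ _ := by gcongr)
      refine ⟨algebraMap R L ⟨y, hy0⟩ + P * y', M.add_mem (M.algebraMap_mem _) (M.mul_mem hPM hy'M), ?_⟩
      have e : x - (algebraMap R L ⟨y, hy0⟩ + P * y') =
          P * ((x - algebraMap K L y) * P⁻¹ - y') := by
        have : algebraMap R L ⟨y, hy0⟩ = algebraMap K L y := rfl
        rw [this]; field_simp; ring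
      rw [e, w.v_mul, hP]
      calc (((m + 1 : ℕ) * q1 : ℚ) : WithTop ℚ) = ((q1 + m * q1 : ℚ) : WithTop ℚ) := by
            congr 1; push_cast; ring
        _ = (q1 : WithTop ℚ) + ((m * q1 : ℚ) : WithTop ℚ) := rfl
        _ ≤ _ := by gcongr
  have harch : ∀ q : ℚ, ∃ m : ℕ, q ≤ m * q1 := by
    intro q
    obtain ⟨m, hm⟩ := exists_nat_ge (q / q1)
    exact ⟨m, by rwa [div_le_iff₀ hq1] at hm⟩
  -- trivial stabilizer
  have hstab : ∀ σ : L ≃ₐ[K] L, σ P = P → σ = 1 := by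
    intro σ hσ
    have hfixM : ∀ y ∈ M, σ y = y := by
      intro y hy
      induction hy using Algebra.adjoin_induction with
      | mem x hx => rw [Set.mem_singleton_iff] at hx; rw [hx, hσ]
      | algebraMap r => exact σ.commutes (r : K)
      | add x y _ _ hx hy => rw [map_add, hx, hy]
      | mul x y _ _ hx hy => rw [map_mul, hx, hy]
    have hfix : ∀ x : L, 0 ≤ w.v x → σ x = x := by
      intro x hx
      by_contra hne
      obtain ⟨q, hq⟩ := w.exists_rat (sub_ne_zero.2 hne)
      obtain ⟨m, hm⟩ := harch (q + 1)
      obtain ⟨y, hyM, hy⟩ := happM m x hx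
      have h1 : σ x - x = σ (x - y) - (x - y) := by
        rw [map_sub, hfixM y hyM]; ring
      have h2 : ((m * q1 : ℚ) : WithTop ℚ) ≤ w.v (σ x - x) := by
        rw [h1]
        exact w.le_v_sub (by rwa [w.v_aut hunr]) hy
      rw [hq] at h2
      have h3 : m * q1 ≤ q := by exact_mod_cast h2
      linarith
    ext x
    rcases w.nonneg_or_inv x with h | h
    · exact hfix x h
    · have := hfix _ h
      rw [map_inv₀] at this
      exact inv_injective this
  have hinj : Function.Injective (fun σ : L ≃ₐ[K] L => σ P) := by
    intro σ τ h
    have h1 : τ⁻¹ * σ = 1 := hstab _ (by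
      change τ.symm (σ P) = P
      rw [AlgEquiv.symm_apply_eq]; exact h)
    exact (inv_mul_eq_one.1 h1).symm
  -- minimal polynomial
  have hint : IsIntegral K P := Algebra.IsIntegral.isIntegral P
  have hcard : Fintype.card (L ≃ₐ[K] L) = Module.finrank K L := by
    rw [← Nat.card_eq_fintype_card]; exact IsGalois.card_aut_eq_finrank K L
  let F : Polynomial L := ∏ σ : L ≃ₐ[K] L, (Polynomial.X - Polynomial.C (σ P))
  have hFmonic : F.Monic := Polynomial.monic_prod_of_monic _ _ fun σ _ => Polynomial.monic_X_sub_C _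
  have hFdeg : F.natDegree = Module.finrank K L := by
    rw [Polynomial.natDegree_prod_of_monic _ _ fun σ _ => Polynomial.monic_X_sub_C _]
    simp [hcard]
  have hdvd : F ∣ (minpoly K P).map (algebraMap K L) := by
    apply Finset.prod_dvd_of_coprime
    · intro σ _ τ _ hne
      exact Polynomial.pairwise_coprime_X_sub_C hinj hne
    · intro σ _
      rw [Polynomial.dvd_iff_isRoot, Polynomial.IsRoot, Polynomial.eval_map_algebraMap]
      have := minpoly.aeval K P
      have h2 := congrArg σ this
      rwa [map_zero, ← Polynomial.aeval_algHom_apply] at h2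
  have hminF : (minpoly K P).map (algebraMap K L) = F :=
    Polynomial.eq_of_monic_of_dvd_of_natDegree_le hFmonic ((minpoly.monic hint).map _) hdvd (by
      rw [Polynomial.natDegree_map, hFdeg]; exact minpoly.natDegree_le P)
  have htop : Algebra.adjoin K {P} = ⊤ := by
    have h1 : (minpoly K P).natDegree = Module.finrank K L := by
      rw [← hFdeg, ← hminF, Polynomial.natDegree_map]
    have h2 := (Field.primitive_element_iff_minpoly_natDegree_eq K P).2 h1
    rw [← IntermediateField.adjoin_simple_toSubalgebra_of_isAlgebraic hint.isAlgebraic, h2]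
    rfl
  have hintR : IsIntegral R P := by
    have hFl : F ∈ Polynomial.lifts w.O.subtype := by
      apply Subsemiring.prod_mem
      intro σ _
      refine ⟨Polynomial.X - Polynomial.C (⟨σ P, ?_⟩ : w.O), by simp⟩
      change 0 ≤ w.v (σ P)
      rw [w.v_aut hunr, hP]
      exact_mod_cast hq1.le
    have hcoef : ∀ i, 0 ≤ w.v (F.coeff i) := by
      intro i
      obtain ⟨c, hc⟩ := (Polynomial.lifts_iff_coeff_lifts _).1 hFl i
      rw [← hc]; exact c.2
    have hml : minpoly K P ∈ Polynomial.lifts R.subtype := by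
      rw [Polynomial.lifts_iff_coeff_lifts]
      intro i
      have h1 : 0 ≤ w.v (algebraMap K L ((minpoly K P).coeff i)) := by
        rw [← Polynomial.coeff_map, hminF]; exact hcoef i
      exact ⟨⟨_, h1⟩, rfl⟩
    obtain ⟨Q, hQ, -, hQm⟩ := Polynomial.lifts_and_natDegree_eq_and_monic hml (minpoly.monic hint)
    refine ⟨Q, hQm, ?_⟩
    have h1 := minpoly.aeval K P
    rw [← hQ, Polynomial.aeval_def, Polynomial.eval₂_map] at h1
    exact h1
  set D : L := Polynomial.aeval P (Polynomial.derivative (minpoly K P)) with hD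
  have hDprod : D = ∏ σ ∈ Finset.univ.erase (1 : L ≃ₐ[K] L), (P - σ P) := by
    rw [hD, ← Polynomial.eval_map_algebraMap, ← Polynomial.derivative_map, hminF]
    change Polynomial.eval P (Polynomial.derivative (∏ σ : L ≃ₐ[K] L, _)) = _
    rw [← Finset.mul_prod_erase Finset.univ _ (Finset.mem_univ (1 : L ≃ₐ[K] L)),
      Polynomial.derivative_mul]
    simp [Polynomial.eval_prod]
  have hD0 : D ≠ 0 := by
    rw [hDprod, Finset.prod_ne_zero_iff]
    intro σ hσ h0
    exact (Finset.ne_of_mem_erase hσ) (hstab σ (sub_eq_zero.1 h0).symm)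
  obtain ⟨qD, hqD⟩ := w.exists_rat hD0
  have hzD := hz D (by
    intro r hr
    have e1 : ∑ᶠ σ ∈ {σ : L ≃ₐ[K] L | σ ≠ 1}, r σ = ∑ σ ∈ Finset.univ.erase (1 : L ≃ₐ[K] L), r σ := by
      rw [← finsum_mem_coe_finset]
      congr 1; ext σ; simp
    rw [e1, hDprod, w.v_prod]
    have e2 : (((∑ σ ∈ Finset.univ.erase (1 : L ≃ₐ[K] L), r σ : ℕ) * q1 : ℚ) : WithTop ℚ)
        = ∑ σ ∈ Finset.univ.erase (1 : L ≃ₐ[K] L), ((r σ * q1 : ℚ) : WithTop ℚ) := by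
      push_cast [Finset.sum_mul]; rfl
    rw [e2]
    apply Finset.sum_le_sum
    intro σ hσ
    rw [← neg_sub, w.v_neg]
    exact hr σ (Finset.ne_of_mem_erase hσ))
  have ht' : algebraMap K L t ≠ 0 := by simpa using ht
  obtain ⟨qt, hqt⟩ := w.exists_rat ht'
  set u : L := z * D * (algebraMap K L t)⁻¹ with hu
  have hu0 : 0 ≤ w.v u := by
    rw [hu, w.v_mul, w.v_mul, w.v_inv_coe hqt]
    calc (0 : WithTop ℚ) = ((qt + -qt : ℚ) : WithTop ℚ) := by simp
      _ = (qt : WithTop ℚ) + ((-qt : ℚ) : WithTop ℚ) := rfl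
      _ ≤ _ := by rw [hqt] at hzD; gcongr
  obtain ⟨m, hm⟩ := harch qD
  obtain ⟨y, hyM, hy⟩ := happM m u hu0
  have htr2 : 0 ≤ w.v (algebraMap K L (Algebra.trace K L ((u - y) * D⁻¹))) := by
    apply w.v_trace_nonneg hunr
    rw [w.v_mul, w.v_inv_coe hqD]
    calc (0 : WithTop ℚ) = ((qD + -qD : ℚ) : WithTop ℚ) := by simp
      _ = (qD : WithTop ℚ) + ((-qD : ℚ) : WithTop ℚ) := rfl
      _ ≤ _ := by
        gcongr
        exact le_trans (by exact_mod_cast hm) hy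
  have htr1 : 0 ≤ w.v (algebraMap K L (Algebra.trace K L (y * D⁻¹))) := by
    have hdual := traceForm_dualSubmodule_adjoin R K htop hintR
    have hmem : D⁻¹ * y ∈ (Algebra.traceForm K L).dualSubmodule (Subalgebra.toSubmodule M) := by
      rw [hdual, Submodule.mem_smul_pointwise_iff_exists]
      exact ⟨y, hyM, rfl⟩
    rw [LinearMap.BilinForm.mem_dualSubmodule] at hmem
    have h1 := hmem 1 M.one_mem
    rw [Submodule.mem_one] at h1
    obtain ⟨c, hc⟩ := h1
    rw [Algebra.traceForm_apply, mul_one, mul_comm] at hc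
    rw [← hc]
    exact c.2
  have hzz : z = t • (y * D⁻¹ + (u - y) * D⁻¹) := by
    rw [Algebra.smul_def, ← add_mul, add_sub_cancel, hu]; field_simp
  rw [hzz, map_smul, map_add, smul_eq_mul, map_mul, map_add, w.v_mul]
  exact le_add_of_nonneg_right (w.le_v_add htr1 htr2)

end galois

end PadicValData

section herbrand

theorem hb_int (g : ℤ → ℝ) (hg : Antitone g) (a b : ℝ) :
    IntervalIntegrable (fun t : ℝ => g ⌈t⌉) MeasureTheory.volume a b := by
  apply Antitone.intervalIntegrable
  intro x y hxy
  exact hg (Int.ceil_mono hxy)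

theorem hb_lower (g : ℤ → ℝ) (hg : Antitone g) (ε : ℝ) (hge : ∀ i, ε ≤ g i)
    (a b : ℝ) (hab : a ≤ b) : ε * (b - a) ≤ ∫ t in a..b, g ⌈t⌉ := by
  have h := intervalIntegral.integral_mono_on hab
    (intervalIntegrable_const (c := ε) (μ := MeasureTheory.volume)) (hb_int g hg a b)
    (fun x _ => hge ⌈x⌉)
  rw [intervalIntegral.integral_const, smul_eq_mul] at h
  linarith

theorem hb_neg (g : ℤ → ℝ) (hg : Antitone g) (ε : ℝ) (hε : 0 < ε) (hge : ∀ i, ε ≤ g i)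
    (u : ℝ) (hu : u < 0) : ∫ t in (0 : ℝ)..u, g ⌈t⌉ < 0 := by
  rw [intervalIntegral.integral_symm]
  have := hb_lower g hg ε hge u 0 hu.le
  have h2 : 0 < ε * (0 - u) := mul_pos hε (by linarith)
  linarith

theorem hb_surj (g : ℤ → ℝ) (hg : Antitone g) (ε : ℝ) (hε : 0 < ε) (hge : ∀ i, ε ≤ g i)
    (m : ℝ) (hm : 0 ≤ m) : ∃ u, ∫ t in (0 : ℝ)..u, g ⌈t⌉ = m := by
  have hcont : Continuous fun u => ∫ t in (0 : ℝ)..u, g ⌈t⌉ :=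
    intervalIntegral.continuous_primitive (fun a b => hb_int g hg a b) 0
  have hpos : (0 : ℝ) ≤ m / ε := by positivity
  have h := intermediate_value_Icc hpos hcont.continuousOn
  have h2 : m ≤ ∫ t in (0 : ℝ)..(m / ε), g ⌈t⌉ := by
    have := hb_lower g hg ε hge 0 (m / ε) hpos
    have e : ε * (m / ε - 0) = m := by field_simp; ring
    linarith
  obtain ⟨u, -, hu⟩ := h ⟨by simpa using hm, h2⟩
  exact ⟨u, hu⟩

theorem hb_sum (g : ℤ → ℝ) (hg : Antitone g) (ε : ℝ) (hε : 0 < ε) (hge : ∀ i, ε ≤ g i)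
    (b : ℝ) (c : ℕ) (hbc : b ≤ c) :
    ∫ t in (0 : ℝ)..b, g ⌈t⌉ ≤ ∑ i ∈ Finset.range c, g (i + 1) := by
  have h1 : ∑ i ∈ Finset.range c, ∫ t in ((i : ℕ) : ℝ)..((i + 1 : ℕ) : ℝ), g ⌈t⌉
      = ∫ t in ((0 : ℕ) : ℝ)..(c : ℝ), g ⌈t⌉ :=
    intervalIntegral.sum_integral_adjacent_intervals (a := fun i : ℕ => (i : ℝ))
      (fun k _ => hb_int g hg _ _)
  have h2 : ∀ i : ℕ, ∫ t in ((i : ℕ) : ℝ)..((i + 1 : ℕ) : ℝ), g ⌈t⌉ = g (i + 1) := by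
    intro i
    have : ∫ t in ((i : ℕ) : ℝ)..((i + 1 : ℕ) : ℝ), g ⌈t⌉
        = ∫ t in ((i : ℕ) : ℝ)..((i + 1 : ℕ) : ℝ), g (i + 1) := by
      apply intervalIntegral.integral_congr_ae
      refine Filter.Eventually.of_forall fun t ht => ?_
      rw [Set.uIoc_of_le (by push_cast; linarith)] at ht
      have : ⌈t⌉ = (i : ℤ) + 1 := by
        rw [Int.ceil_eq_iff]
        have h3 := ht.1
        have h4 := ht.2
        push_cast at h4 ⊢
        constructor <;> linarith
      rw [this]
    rw [this, intervalIntegral.integral_const]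
    simp
  rw [Finset.sum_congr rfl (fun i _ => (h2 i).symm), h1]
  have h3 := intervalIntegral.integral_add_adjacent_intervals
    (hb_int g hg 0 b) (hb_int g hg b (c : ℝ))
  have h4 := hb_lower g hg ε hge b c hbc
  have h5 : 0 ≤ ε * (c - b) := mul_nonneg hε.le (by linarith)
  rw [Nat.cast_zero]
  linarith

end herbrand

section ram

variable {p : ℕ} {A : Type} [Field A]

theorem InMaxIdealPow_mono (vd : PadicValData A p) {F : Type} [Field F] (emb : F →+* A)
    {i j : ℕ} (hij : i ≤ j) {y : A} (h : InMaxIdealPow vd emb j y) : InMaxIdealPow vd emb i y := by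
  induction j, hij using Nat.le_induction with
  | base => exact h
  | succ j _ ih =>
    apply ih
    obtain ⟨u, s, hu, hs, rfl⟩ := h
    refine ⟨u * s 0, fun k => s k.succ, ?_, fun k => hs _, ?_⟩
    · rw [map_mul, vd.v_mul]; exact add_nonneg hu (hs 0).le
    · rw [Fin.prod_univ_succ, map_mul, mul_assoc]

theorem InMaxIdealPow_v (vd : PadicValData A p) {F : Type} [Field F] (emb : F →+* A)
    (q1 : ℚ) (hmin : ∀ y : F, 0 < vd.v (emb y) → (q1 : WithTop ℚ) ≤ vd.v (emb y))
    {j : ℕ} {y : A} (h : InMaxIdealPow vd emb j y) : ((j * q1 : ℚ) : WithTop ℚ) ≤ vd.v y := by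
  obtain ⟨u, s, hu, hs, rfl⟩ := h
  rw [vd.v_mul, vd.v_prod]
  have h1 : ((j * q1 : ℚ) : WithTop ℚ) = ∑ _k : Fin j, (q1 : WithTop ℚ) := by
    rw [Finset.sum_const, Finset.card_univ, Fintype.card_fin, ← nsmul_eq_mul]; rfl
  rw [h1]
  exact le_add_of_nonneg_of_le hu (Finset.sum_le_sum fun k _ => hmin _ (hs k))

variable {K L : Type} [Field K] [Field L] [Algebra K L]

theorem lowerRamSet_anti (vd : PadicValData A p) (emb : L →+* A) {i j : ℤ} (hij : i ≤ j) :
    lowerRamSet vd K L emb j ⊆ lowerRamSet vd K L emb i := fun _ hσ x hx =>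
  InMaxIdealPow_mono vd emb (by omega) (hσ x hx)

theorem one_mem_lowerRamSet (vd : PadicValData A p) (emb : L →+* A) (i : ℤ) :
    (1 : L ≃ₐ[K] L) ∈ lowerRamSet vd K L emb i := by
  intro x _
  refine ⟨0, fun _ => (p : L), by simp [vd.v_zero], fun k => ?_, by simp⟩
  rw [map_natCast, vd.v_coe_p]; norm_num

theorem ram_key [FiniteDimensional K L] (vd : PadicValData A p) (emb : L →+* A) (n : ℕ)
    (h0 : upperRamSet vd K L emb 0 = Set.univ) :
    lowerRamSet vd K L emb 0 = Set.univ ∧ ∃ c : ℕ,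
      upperRamSet vd K L emb n = lowerRamSet vd K L emb c ∧
      (n + 1) * Nat.card (L ≃ₐ[K] L) ≤
        ∑ i ∈ Finset.range (c + 1), Nat.card ↥(lowerRamSet vd K L emb (i : ℤ)) := by
  classical
  set N0 : ℝ := (Nat.card ↥(lowerRamSet vd K L emb 0) : ℝ) with hN0
  have hpos : ∀ i, 0 < Nat.card ↥(lowerRamSet vd K L emb i) := by
    intro i
    haveI : Nonempty ↥(lowerRamSet vd K L emb i) := ⟨⟨1, one_mem_lowerRamSet vd emb i⟩⟩
    exact Nat.card_pos
  have hN0pos : 0 < N0 := by rw [hN0]; exact_mod_cast hpos 0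
  let g : ℤ → ℝ := fun i => (Nat.card ↥(lowerRamSet vd K L emb i) : ℝ) / N0
  have hg : Antitone g := by
    intro i j hij
    have : Nat.card ↥(lowerRamSet vd K L emb j) ≤ Nat.card ↥(lowerRamSet vd K L emb i) :=
      Nat.card_mono (Set.toFinite _) (lowerRamSet_anti vd emb hij)
    have h2 : (Nat.card ↥(lowerRamSet vd K L emb j) : ℝ) ≤ Nat.card ↥(lowerRamSet vd K L emb i) := by
      exact_mod_cast this
    simp only [g]
    gcongr
  have hε : 0 < 1 / N0 := by positivity
  have hge : ∀ i, 1 / N0 ≤ g i := by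
    intro i
    have : (1 : ℝ) ≤ Nat.card ↥(lowerRamSet vd K L emb i) := by exact_mod_cast hpos i
    simp only [g]
    gcongr
  have hphi : ∀ u, herbrandPhi vd K L emb u = ∫ t in (0 : ℝ)..u, g ⌈t⌉ := fun u => rfl
  have hpsi : ∀ m : ℝ, 0 ≤ m → herbrandPhi vd K L emb (herbrandPsi vd K L emb m) = m ∧
      0 ≤ herbrandPsi vd K L emb m := by
    intro m hm
    have h1 : herbrandPhi vd K L emb (herbrandPsi vd K L emb m) = m :=
      Function.invFun_eq (hb_surj g hg _ hε hge m hm)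
    refine ⟨h1, ?_⟩
    by_contra! hlt
    have := hb_neg g hg _ hε hge _ hlt
    rw [← hphi, h1] at this
    linarith
  have hG0 : lowerRamSet vd K L emb 0 = Set.univ := by
    rw [← Set.univ_subset_iff, ← h0]
    apply lowerRamSet_anti
    have := (hpsi 0 le_rfl).2
    simpa using Int.ceil_nonneg this
  refine ⟨hG0, ?_⟩
  obtain ⟨hn1, hn2⟩ := hpsi n (Nat.cast_nonneg n)
  obtain ⟨c, hc⟩ := Int.eq_ofNat_of_zero_le (Int.ceil_nonneg hn2)
  refine ⟨c, by simp only [upperRamSet, Int.cast_natCast, hc], ?_⟩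
  have hbc : herbrandPsi vd K L emb n ≤ c := by
    have := Int.le_ceil (herbrandPsi vd K L emb n)
    rw [hc] at this
    exact_mod_cast this
  have hs := hb_sum g hg _ hε hge _ c hbc
  rw [← hphi, hn1] at hs
  have hcardG : Nat.card ↥(lowerRamSet vd K L emb 0) = Nat.card (L ≃ₐ[K] L) := by
    rw [hG0, Nat.card_univ]
  simp only [g] at hs
  rw [← Finset.sum_div, le_div_iff₀ hN0pos, hN0, hcardG] at hs
  rw [Finset.sum_range_succ', Nat.cast_zero, hcardG]
  have hs' : n * Nat.card (L ≃ₐ[K] L) ≤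
      ∑ i ∈ Finset.range c, Nat.card ↥(lowerRamSet vd K L emb ((i : ℤ) + 1)) := by
    exact_mod_cast hs
  push_cast
  linarith

end ram

theorem char_sum_est {p : ℕ} {A : Type} [Field A] (vd : PadicValData A p) {G : Type*} [Group G]
    [Fintype G] (H : Subgroup G) (χ : G →* A) (τ : G) (hτ : τ ∈ H) (hχ : χ τ ≠ 1) (T : G → A)
    (C : WithTop ℚ) (hT : ∀ γ, ∀ h ∈ H, C ≤ vd.v (T (γ * h) - T γ)) :
    C ≤ vd.v (∑ γ, χ γ * T γ) := by
  classical
  let rep : G → G := fun γ => Quotient.out (QuotientGroup.mk (s := H) γ)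
  have hrep : ∀ γ, rep (γ * τ) = rep γ := by
    intro γ
    have : (QuotientGroup.mk (s := H) (γ * τ)) = QuotientGroup.mk (s := H) γ := by
      rw [QuotientGroup.mk_mul_of_mem γ hτ]
    simp only [rep, this]
  have hrep2 : ∀ γ, ∃ h ∈ H, rep γ = γ * h := by
    intro γ
    obtain ⟨h, hh⟩ := QuotientGroup.mk_out_eq_mul H γ
    exact ⟨h, h.2, hh⟩
  have h0 : ∑ γ, χ γ * T (rep γ) = 0 := by
    have h1 : ∑ γ, χ γ * T (rep γ) = χ τ * ∑ γ, χ γ * T (rep γ) := by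
      rw [Finset.mul_sum]
      rw [← Equiv.sum_comp (Equiv.mulRight τ)]
      refine Finset.sum_congr rfl fun γ _ => ?_
      simp only [Equiv.coe_mulRight, hrep, map_mul]
      ring
    have h2 : (χ τ - 1) * ∑ γ, χ γ * T (rep γ) = 0 := by
      rw [sub_mul, one_mul, ← h1, sub_self]
    exact (mul_eq_zero.1 h2).resolve_left (sub_ne_zero.2 hχ)
  have h3 : ∑ γ, χ γ * T γ = - ∑ γ, χ γ * (T (rep γ) - T γ) := by
    simp only [mul_sub, Finset.sum_sub_distrib, h0]
    ring
  rw [h3, vd.v_neg]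
  refine vd.le_v_sum _ _ fun γ _ => ?_
  have hv : vd.v (χ γ) = 0 := by
    have h4 : χ γ ^ Fintype.card G = 1 := by
      rw [← map_pow, pow_card_eq_one, map_one]
    have hne : χ γ ≠ 0 := by
      intro h
      rw [h, zero_pow Fintype.card_ne_zero] at h4
      exact zero_ne_one h4
    obtain ⟨q, hq⟩ := vd.exists_rat hne
    have h5 := vd.v_pow_coe hq (Fintype.card G)
    rw [h4, vd.v_one] at h5
    have h6 : (0 : ℚ) = Fintype.card G * q := by exact_mod_cast h5
    have h7 : q = 0 := by
      rcases mul_eq_zero.1 h6.symm with h | h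
      · exact absurd (by exact_mod_cast h) (Fintype.card_ne_zero (α := G))
      · exact h
    rw [hq, h7]; rfl
  rw [vd.v_mul, hv, zero_add]
  obtain ⟨h, hh, he⟩ := hrep2 γ
  rw [he]
  exact hT γ h hh

theorem resolvent_prod {A : Type} [Field A] (K L : Type) [Field K] [Field L]
    [Algebra K L] [FiniteDimensional K L] [IsGalois K L]
    (emb : L →+* A) (χ : (L ≃ₐ[K] L) →* A) (α β : L) :
    localResolvent K L emb (⇑χ) α * localResolvent K L emb (fun γ => χ γ⁻¹) β
      = (∑ᶠ γ : L ≃ₐ[K] L,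
          χ γ * (emb.comp (algebraMap K L)) (Algebra.trace K L (γ α * β))) := by
  classical
  unfold localResolvent
  rw [finsum_eq_sum_of_fintype, finsum_eq_sum_of_fintype, finsum_eq_sum_of_fintype]
  rw [Finset.mul_sum]
  have h1 : ∀ δ : L ≃ₐ[K] L, (∑ γ : L ≃ₐ[K] L, χ γ * emb (γ α)) * (χ δ⁻¹ * emb (δ β))
      = ∑ γ : L ≃ₐ[K] L, χ γ * emb (δ (γ α * β)) := by
    intro δ
    rw [← Equiv.sum_comp (Equiv.mulLeft δ), Finset.sum_mul]
    refine Finset.sum_congr rfl fun γ _ => ?_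
    have hd : χ δ * χ δ⁻¹ = 1 := by rw [← map_mul, mul_inv_cancel, map_one]
    simp only [Equiv.coe_mulLeft, map_mul, AlgEquiv.mul_apply]
    linear_combination (χ γ * emb (δ (γ α)) * emb (δ β)) * hd
  rw [Finset.sum_congr rfl fun δ _ => h1 δ, Finset.sum_comm]
  refine Finset.sum_congr rfl fun γ _ => ?_
  rw [RingHom.comp_apply, trace_eq_sum_automorphisms, map_sum, Finset.mul_sum]

theorem trace_final {p : ℕ} [Fact p.Prime]
    {A : Type} [Field A] (vd : PadicValData A p)
    (K L : Type) [Field K] [Field L]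
    [Algebra K L] [FiniteDimensional K L] [IsGalois K L]
    (emb : L →+* A) (π : K) (q0 : ℚ)
    (hπ0 : π ≠ 0) (n c : ℕ)
    (hunr : ∀ (σ : L ≃ₐ[K] L) (x : L), 0 ≤ (vd.comap emb).v x → 0 < (vd.comap emb).v (σ x - x))
    (happ : ∀ x : L, 0 ≤ (vd.comap emb).v x →
      ∃ y : K, 0 ≤ (vd.comap emb).v (algebraMap K L y) ∧
        0 < (vd.comap emb).v (x - algebraMap K L y))
    (hπ : (vd.comap emb).v (algebraMap K L π) = q0)
    (P : L) (q1 : ℚ) (hq1 : 0 < q1) (hP : (vd.comap emb).v P = q1)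
    (hmin : ∀ y : L, 0 < (vd.comap emb).v y → (q1 : WithTop ℚ) ≤ (vd.comap emb).v y)
    (hle : q0 ≤ Nat.card (L ≃ₐ[K] L) * q1)
    (hc : (n + 1) * Nat.card (L ≃ₐ[K] L) ≤
        ∑ i ∈ Finset.range (c + 1), Nat.card ↥(lowerRamSet vd K L emb (i : ℤ)))
    (z : L) (hz : ((((c : ℚ) + 1) * q1 : ℚ) : WithTop ℚ) ≤ (vd.comap emb).v z) :
    (((n + 1 : ℕ) * q0 : ℚ) : WithTop ℚ) ≤
      (vd.comap emb).v (algebraMap K L (Algebra.trace K L z)) := by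
  classical
  have hpi : (vd.comap emb).v (algebraMap K L (π ^ (n + 1))) = (((n + 1 : ℕ) * q0 : ℚ) : WithTop ℚ) := by
    rw [map_pow, (vd.comap emb).v_pow_coe hπ]
  rw [← hpi]
  refine (vd.comap emb).trace_bound hunr happ P q1 hq1 hP hmin _ (pow_ne_zero _ hπ0) z ?_
  intro D hD
  let r : (L ≃ₐ[K] L) → ℕ := fun σ =>
    ((Finset.range (c + 1)).filter (fun i : ℕ => σ ∈ lowerRamSet vd K L emb (i : ℤ))).card
  have hP0 : 0 ≤ (vd.comap emb).v P := by rw [hP]; exact_mod_cast hq1.le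
  have hD' := hD r (by
    intro σ _
    rcases Nat.eq_zero_or_pos (r σ) with h0 | h0
    · rw [h0]; simpa using (hunr σ P hP0).le
    · obtain ⟨i, hi, hir⟩ : ∃ i : ℕ, σ ∈ lowerRamSet vd K L emb (i : ℤ) ∧ r σ ≤ i + 1 := by
        by_contra hcon
        push Not at hcon
        have hsub : ((Finset.range (c + 1)).filter
            (fun i : ℕ => σ ∈ lowerRamSet vd K L emb (i : ℤ))) ⊆ Finset.range (r σ - 1) := by
          intro i hi
          have := hcon i (Finset.mem_filter.1 hi).2
          rw [Finset.mem_range]; omega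
        have h2 := Finset.card_le_card hsub
        rw [Finset.card_range] at h2
        change r σ ≤ _ at h2
        omega
      have h3 := InMaxIdealPow_v vd emb q1 hmin (hi P hP0)
      rw [← map_sub] at h3
      refine le_trans ?_ h3
      have e : ((i : ℤ) + 1).toNat = i + 1 := by omega
      rw [e]
      have : ((r σ : ℕ) : ℚ) ≤ ((i + 1 : ℕ) : ℚ) := by exact_mod_cast hir
      exact WithTop.coe_le_coe.2 (mul_le_mul_of_nonneg_right this hq1.le))
  have hsum : ∑ σ, r σ = ∑ i ∈ Finset.range (c + 1), Nat.card ↥(lowerRamSet vd K L emb (i : ℤ)) := by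
    simp only [r, Finset.card_filter]
    rw [Finset.sum_comm]
    refine Finset.sum_congr rfl fun i _ => ?_
    rw [← Finset.card_filter, Nat.card_eq_fintype_card, Fintype.card_subtype]
  have hr1 : r 1 ≤ c + 1 := by
    refine (Finset.card_filter_le _ _).trans ?_
    simp
  have hfs : (∑ᶠ σ ∈ {σ : L ≃ₐ[K] L | σ ≠ 1}, r σ) = ∑ σ ∈ Finset.univ.erase 1, r σ := by
    rw [finsum_mem_eq_finite_toFinset_sum _ (Set.toFinite _)]
    refine Finset.sum_congr ?_ fun _ _ => rfl
    ext σ; simp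
  rw [hfs] at hD'
  have hadd := Finset.add_sum_erase Finset.univ r (Finset.mem_univ 1)
  set S := ∑ σ ∈ Finset.univ.erase 1, r σ
  have hfin : (n + 1) * Nat.card (L ≃ₐ[K] L) ≤ (c + 1) + S := by omega
  have hfq : ((n : ℚ) + 1) * Nat.card (L ≃ₐ[K] L) ≤ (c + 1) + S := by exact_mod_cast hfin
  rw [hpi]
  refine le_trans ?_ (add_le_add hz hD')
  rw [← WithTop.coe_add]
  refine WithTop.coe_le_coe.2 ?_
  push_cast
  have h5 := mul_le_mul_of_nonneg_left hle (show (0 : ℚ) ≤ n + 1 by positivity)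
  have h6 := mul_le_mul_of_nonneg_right hfq hq1.le
  nlinarith

section

/-- (Theorem 2.6 i)). Let `L/K` satisfy condition (ram) with parameter
`n`, and let `χ` be a character of `G = Gal(L/K)` of conductor `p^{n+1}` (i.e. `χ` is
nontrivial on `G^n`). Then for all `α, β ∈ O_L`, the product of local resolvents
satisfies `⟨α|χ⟩·⟨β|χ⁻¹⟩ = ∑_{γ ∈ G} Tr_{L/K}(α^γ β)·χ(γ) ≡ 0 mod π^{n+1}`. -/
theorem statement4 {p : ℕ} [Fact p.Prime] (hp : Odd p)
    {A : Type} [Field A] (vd : PadicValData A p)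
    (K L : Type) [Field K] [Field L]
    [Algebra ℚ_[p] K] [FiniteDimensional ℚ_[p] K]
    [Algebra K L] [FiniteDimensional K L] [IsGalois K L]
    (emb : L →+* A)
    (hab : ∀ σ τ : L ≃ₐ[K] L, σ * τ = τ * σ)
    (π : K) (hπ : IsUniformizer vd (emb.comp (algebraMap K L)) π)
    (n : ℕ) (hram : RamCond vd K L emb n)
    (χ : (L ≃ₐ[K] L) →* A)
    (hcond : ∃ τ ∈ upperRamSet vd K L emb (n : ℤ), χ τ ≠ 1)
    (α β : L) (hα : 0 ≤ vd.v (emb α)) (hβ : 0 ≤ vd.v (emb β)) :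
    localResolvent K L emb (⇑χ) α * localResolvent K L emb (fun γ => χ γ⁻¹) β
      = (∑ᶠ γ : L ≃ₐ[K] L,
          χ γ * (emb.comp (algebraMap K L)) (Algebra.trace K L (γ α * β))) ∧
    (n + 1) • vd.v ((emb.comp (algebraMap K L)) π)
      ≤ vd.v (localResolvent K L emb (⇑χ) α
          * localResolvent K L emb (fun γ => χ γ⁻¹) β) := by
  classical
  refine and_iff_left_of_imp (fun h => ?_) |>.2 (resolvent_prod K L emb χ α β)
  rw [h, finsum_eq_sum_of_fintype]
  obtain ⟨hG0, c, hup, hc⟩ := ram_key (K := K) (L := L) vd emb n hram.2.1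
  obtain ⟨hπ0, hπpos, hπmin⟩ := hπ
  have hunr : ∀ (σ : L ≃ₐ[K] L) (x : L), 0 ≤ (vd.comap emb).v x →
      0 < (vd.comap emb).v (σ x - x) := by
    intro σ x hx
    have h1 : σ ∈ lowerRamSet vd K L emb 0 := by rw [hG0]; trivial
    obtain ⟨u, s, hu, hs, he⟩ := h1 x hx
    change 0 < vd.v (emb (σ x - x))
    rw [map_sub, he, vd.v_mul]
    have e : ∏ k, emb (s k) = emb (s ⟨0, by simp⟩) := by
      exact Fin.prod_univ_one (fun k => emb (s k))
    rw [e]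
    exact lt_of_lt_of_le (hs _) (le_add_of_nonneg_left hu)
  obtain ⟨q0, hq0⟩ := ((vd.comap emb).comap (algebraMap K L)).exists_rat hπ0
  have hq0' : (vd.comap emb).v (algebraMap K L π) = q0 := hq0
  have hq0'' : vd.v ((emb.comp (algebraMap K L)) π) = q0 := hq0
  rw [hq0''] at hπpos hπmin
  have hq0pos : 0 < q0 := by exact_mod_cast hπpos
  have hZ : ∀ x : ℤ_[p], 0 ≤ (vd.comap emb).v (algebraMap K L (algebraMap ℚ_[p] K x)) :=
    ((vd.comap emb).comap (algebraMap K L)).padicInt_nonneg q0 hq0pos hπmin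
  have happ := (vd.comap emb).approx hunr hZ
  obtain ⟨P, q1, hq1, hP, hmin, hle⟩ := (vd.comap emb).exists_unif hunr π q0 hq0pos hq0' hπmin
  have htr := trace_final vd K L emb π q0 hπ0 n c hunr happ hq0' P q1 hq1 hP hmin hle hc
  let H : Subgroup (L ≃ₐ[K] L) :=
    { carrier := {σ | ∀ x, 0 ≤ (vd.comap emb).v x →
        ((((c : ℚ) + 1) * q1 : ℚ) : WithTop ℚ) ≤ (vd.comap emb).v (σ x - x)}
      one_mem' := by
        intro x _
        simp [PadicValData.v_zero]
      mul_mem' := by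
        intro σ τ hσ hτ x hx
        have e : (σ * τ) x - x = (σ (τ x) - τ x) + (τ x - x) := by
          rw [AlgEquiv.mul_apply]; ring
        rw [e]
        refine (vd.comap emb).le_v_add (hσ _ ?_) (hτ x hx)
        rwa [(vd.comap emb).v_aut hunr]
      inv_mem' := by
        intro σ hσ x hx
        have h1 := hσ (σ⁻¹ x) (by rwa [(vd.comap emb).v_aut hunr])
        have e : σ (σ⁻¹ x) = x := by rw [← AlgEquiv.mul_apply, mul_inv_cancel]; rfl
        rw [e, ← neg_sub, (vd.comap emb).v_neg] at h1
        exact h1 }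
  obtain ⟨τ, hτ, hχ⟩ := hcond
  rw [hup] at hτ
  have hτH : τ ∈ H := by
    intro x hx
    have h3 := InMaxIdealPow_v vd emb q1 hmin (hτ x hx)
    rw [← map_sub] at h3
    have e : ((c : ℤ) + 1).toNat = c + 1 := by omega
    rw [e] at h3
    push_cast at h3
    exact h3
  have hgoal : (n + 1) • vd.v ((emb.comp (algebraMap K L)) π)
      = (((n + 1 : ℕ) * q0 : ℚ) : WithTop ℚ) := by
    rw [← vd.v_pow, vd.v_pow_coe hq0'']
  rw [hgoal]
  refine char_sum_est vd H χ τ hτH hχ _ _ ?_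
  intro γ h hh
  rw [← map_sub, ← map_sub]
  refine htr _ ?_
  have e : (γ * h) α * β - γ α * β = (h (γ α) - γ α) * β := by
    rw [hab γ h, AlgEquiv.mul_apply]; ring
  rw [e, (vd.comap emb).v_mul]
  have h1 := hh (γ α) (by rw [(vd.comap emb).v_aut hunr]; exact hα)
  exact le_add_of_le_of_nonneg h1 hβ

end
end

section
/- Let L/K satisfy condition (ram) with n = 0 (so L/K is tamely ramified of degree p−1), and let χ be a nontrivial character of G = Gal(L/K). Then there exist α, β ∈ O_L such that v_π(⟨α|χ⟩) + v_π(⟨β|χ^{-1}⟩) = v_π(Σ_{γ∈G} Tr_{L/K}(α^γ β)·χ(γ)) = 1. -/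
theorem aux_root {p : ℕ} [Fact p.Prime] (a : (ZMod p)ˣ) :
    ∃ z : ℤ_[p], z ^ (p - 1) = 1 ∧ PadicInt.toZMod z = (a : ZMod p) := by
  obtain ⟨z0, hz0⟩ := ZMod.ringHom_surjective (PadicInt.toZMod (p := p)) (a : ZMod p)
  have hp1 : p - 1 ≠ 0 := by have := (Fact.out : p.Prime).two_le; omega
  have hk : ∀ x : ℤ_[p], x ∈ IsLocalRing.maximalIdeal ℤ_[p] ↔ PadicInt.toZMod x = 0 := by
    intro x; rw [← PadicInt.ker_toZMod, RingHom.mem_ker]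
  have ha : (a : ZMod p) ^ (p - 1) = 1 := ZMod.pow_card_sub_one_eq_one a.ne_zero
  obtain ⟨z, hz, hzz⟩ := HenselianRing.is_henselian (I := IsLocalRing.maximalIdeal ℤ_[p])
    (Polynomial.X ^ (p - 1) - 1 : Polynomial ℤ_[p])
    (by simpa using Polynomial.monic_X_pow_sub_C (1 : ℤ_[p]) hp1) z0
    (by rw [hk]; simp [hz0, ha])
    (by
      apply IsUnit.map
      by_contra hu
      rw [← mem_nonunits_iff, ← IsLocalRing.mem_maximalIdeal, hk] at hu
      simp [Polynomial.derivative_X_pow, hz0] at hu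
      have h2 : ((p - 1 : ℕ) : ZMod p) = -1 := by
        rw [Nat.cast_sub (Fact.out : p.Prime).one_le]; simp
      rw [h2] at hu
      simp at hu)
  refine ⟨z, ?_, ?_⟩
  · simpa [sub_eq_zero] using hz
  · rw [hk, map_sub, sub_eq_zero] at hzz
    rw [hzz, hz0]

theorem aux_roots_lift {p : ℕ} [Fact p.Prime] {A : Type} [Field A] (f : ℤ_[p] →+* A)
    (hf : Function.Injective f) (ζ : A) (hζ : ζ ^ (p - 1) = 1) : ∃ z, f z = ζ := by
  classical
  choose z hz1 hz2 using aux_root (p := p)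
  have hp1 : 0 < p - 1 := by have := (Fact.out : p.Prime).two_le; omega
  have hinj : Function.Injective (fun a => f (z a)) := by
    intro a b hab
    have := hf hab
    apply Units.ext
    rw [← hz2 a, ← hz2 b, this]
  have hsub : Finset.univ.image (fun a => f (z a)) ⊆ Polynomial.nthRootsFinset (p - 1) (1 : A) := by
    intro x hx
    obtain ⟨a, -, rfl⟩ := Finset.mem_image.1 hx
    rw [Polynomial.mem_nthRootsFinset hp1, ← map_pow, hz1, map_one]
  have hcard : (Polynomial.nthRootsFinset (p - 1) (1 : A)).card ≤
      (Finset.univ.image (fun a => f (z a))).card := by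
    rw [Finset.card_image_of_injective _ hinj, Finset.card_univ, ZMod.card_units]
    rw [Polynomial.nthRootsFinset]
    exact (Multiset.toFinset_card_le _).trans (Polynomial.card_nthRoots _ _)
  have heq := Finset.eq_of_subset_of_card_le hsub hcard
  have hm : ζ ∈ Polynomial.nthRootsFinset (p - 1) (1 : A) :=
    (Polynomial.mem_nthRootsFinset hp1 _).2 hζ
  rw [← heq] at hm
  obtain ⟨a, -, h⟩ := Finset.mem_image.1 hm
  exact ⟨_, h⟩

theorem aux_v_one {p : ℕ} {A : Type} [Field A] (vd : PadicValData A p) : vd.v 1 = 0 := by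
  have h := vd.v_mul 1 1
  have h1 : vd.v 1 ≠ ⊤ := by rw [Ne, vd.v_top_iff]; exact one_ne_zero
  obtain ⟨q, hq⟩ := WithTop.ne_top_iff_exists.1 h1
  rw [mul_one, ← hq] at h
  rw [← hq]
  norm_cast at h ⊢
  linarith

theorem aux_v_neg_one {p : ℕ} {A : Type} [Field A] (vd : PadicValData A p) : vd.v (-1) = 0 := by
  have h := vd.v_mul (-1) (-1)
  have h1 : vd.v (-1) ≠ ⊤ := by rw [Ne, vd.v_top_iff]; simp
  obtain ⟨q, hq⟩ := WithTop.ne_top_iff_exists.1 h1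
  rw [neg_mul_neg, one_mul, aux_v_one, ← hq] at h
  rw [← hq]
  norm_cast at h ⊢
  linarith

theorem aux_v_pm1 {p : ℕ} (hp : 1 ≤ p) {A : Type} [Field A] (vd : PadicValData A p) :
    vd.v ((p - 1 : ℕ) : A) = 0 := by
  have hnat : ∀ n : ℕ, 0 ≤ vd.v (n : A) := by
    intro n
    induction n with
    | zero => rw [Nat.cast_zero, (vd.v_top_iff 0).2 rfl]; exact le_top
    | succ n ih =>
      rw [Nat.cast_succ]
      refine le_trans ?_ (vd.v_min_le_add _ _)
      rw [aux_v_one]; exact le_min ih le_rfl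
  refine le_antisymm ?_ (hnat _)
  by_contra hlt
  rw [not_le] at hlt
  have h := vd.v_min_le_add (p : A) (-1 * ((p - 1 : ℕ) : A))
  have e : (p : A) + -1 * ((p - 1 : ℕ) : A) = 1 := by
    rw [Nat.cast_sub hp]; push_cast; ring
  rw [e, aux_v_one, vd.v_mul, aux_v_neg_one, zero_add, vd.v_coe_p] at h
  rcases min_le_iff.1 h with h | h
  · exact absurd h (by norm_num)
  · exact absurd h (not_le.2 hlt)

theorem aux_scale {p : ℕ} {A F : Type} [Field A] [Field F] (vd : PadicValData A p)
    (e : F →+* A) (π α : F) (hα : α ≠ 0) (hπ0 : π ≠ 0) (hπ : 0 < vd.v (e π)) :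
    ∃ k : ℤ, 0 ≤ vd.v (e (π ^ k * α)) ∧ 0 ≤ vd.v (e (π / (π ^ k * α))) := by
  have hfin : ∀ x : F, x ≠ 0 → ∃ q : ℚ, vd.v (e x) = q := by
    intro x hx
    have h1 : vd.v (e x) ≠ ⊤ := by rw [Ne, vd.v_top_iff]; simpa using hx
    obtain ⟨q, hq⟩ := WithTop.ne_top_iff_exists.1 h1
    exact ⟨q, hq.symm⟩
  choose! w hw using hfin
  have hmul : ∀ x y, x ≠ 0 → y ≠ 0 → w (x * y) = w x + w y := by
    intro x y hx hy
    have h := vd.v_mul (e x) (e y)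
    rw [← map_mul, hw _ (mul_ne_zero hx hy), hw x hx, hw y hy] at h
    exact_mod_cast h
  let W : Fˣ →* Multiplicative ℚ :=
    { toFun := fun u => Multiplicative.ofAdd (w u)
      map_one' := by
        have h := hmul 1 1 one_ne_zero one_ne_zero
        rw [mul_one] at h
        have : w 1 = 0 := by linarith
        simp [this]
      map_mul' := fun x y => by
        rw [Units.val_mul, hmul _ _ x.ne_zero y.ne_zero]; rfl }
  have hpow : ∀ k : ℤ, w (π ^ k) = k * w π := by
    intro k
    have h := map_zpow W (Units.mk0 π hπ0) k
    have h2 := congrArg Multiplicative.toAdd h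
    simpa [W] using h2
  have hpos : 0 < w π := by
    rw [hw π hπ0] at hπ; exact_mod_cast hπ
  have hk : ∀ k : ℤ, π ^ k * α ≠ 0 := fun k => mul_ne_zero (zpow_ne_zero _ hπ0) hα
  set m := ⌊w α / w π⌋ with hm
  have h1 : (m : ℚ) * w π ≤ w α := by
    have := Int.floor_le (w α / w π)
    rwa [le_div_iff₀ hpos] at this
  have h2 : w α < ((m : ℚ) + 1) * w π := by
    have := Int.lt_floor_add_one (w α / w π)
    rwa [div_lt_iff₀ hpos] at this
  have hv : w (π ^ (-m) * α) = w α - m * w π := by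
    rw [hmul _ _ (zpow_ne_zero _ hπ0) hα, hpow]; push_cast; ring
  have hv2 : w (π / (π ^ (-m) * α)) + w (π ^ (-m) * α) = w π := by
    rw [← hmul _ _ (div_ne_zero hπ0 (hk _)) (hk _), div_mul_cancel₀ _ (hk _)]
  refine ⟨-m, ?_, ?_⟩
  · rw [hw _ (hk _), hv]
    have : 0 ≤ w α - m * w π := by linarith
    exact_mod_cast this
  · rw [hw _ (div_ne_zero hπ0 (hk _))]
    have : 0 ≤ w (π / (π ^ (-m) * α)) := by rw [hv] at hv2; linarith
    exact_mod_cast this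

theorem aux_eigen {K L : Type} [Field K] [Field L] [Algebra K L] [FiniteDimensional K L]
    (c : (L ≃ₐ[K] L) →* K) :
    ∃ α : L, α ≠ 0 ∧ ∀ γ : L ≃ₐ[K] L, γ α = algebraMap K L (c γ⁻¹) * α := by
  classical
  have hli := linearIndependent_monoidHom L L
  let i : (L ≃ₐ[K] L) → (L →* L) := fun γ => ((γ : L →ₐ[K] L) : L →* L)
  have hi : Function.Injective i := by
    intro a b h
    ext x
    exact DFunLike.congr_fun h x
  have hli2 := hli.comp i hi
  rw [Fintype.linearIndependent_iff] at hli2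
  have hex : ∃ x : L, ∑ γ : L ≃ₐ[K] L, algebraMap K L (c γ) * γ x ≠ 0 := by
    by_contra hno
    push Not at hno
    have h0 := hli2 (fun γ => algebraMap K L (c γ)) (by
      ext x
      simpa [i, Algebra.smul_def] using hno x) 1
    simp at h0
  obtain ⟨x, hx⟩ := hex
  refine ⟨_, hx, fun γ => ?_⟩
  rw [map_sum, Finset.mul_sum]
  rw [← Equiv.sum_comp (Equiv.mulLeft γ) (fun δ => algebraMap K L (c γ⁻¹) *
    (algebraMap K L (c δ) * δ x))]
  refine Finset.sum_congr rfl fun δ _ => ?_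
  simp only [Equiv.coe_mulLeft, map_mul, AlgEquiv.commutes, AlgEquiv.mul_apply]
  rw [← mul_assoc, ← mul_assoc, ← map_mul (algebraMap K L), ← map_mul c, inv_mul_cancel, map_one,
    map_one, one_mul]

section

/-- (Theorem 2.6 ii)). Let `L/K` satisfy condition (ram) with `n = 0`
(so `L/K` is tamely ramified of degree `p−1`), and let `χ` be a nontrivial character of
`G = Gal(L/K)`. Then there exist `α, β ∈ O_L` such that
`v_π(⟨α|χ⟩) + v_π(⟨β|χ⁻¹⟩) = v_π(∑_{γ∈G} Tr_{L/K}(α^γ β)·χ(γ)) = 1`,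
where `v_π` is normalized by `v_π(π) = 1`. -/
theorem statement5 {p : ℕ} [Fact p.Prime] (hp : Odd p)
    {A : Type} [Field A] (vd : PadicValData A p)
    (K L : Type) [Field K] [Field L]
    [Algebra ℚ_[p] K] [FiniteDimensional ℚ_[p] K]
    [Algebra K L] [FiniteDimensional K L] [IsGalois K L]
    (emb : L →+* A)
    (hab : ∀ σ τ : L ≃ₐ[K] L, σ * τ = τ * σ)
    (π : K) (hπ : IsUniformizer vd (emb.comp (algebraMap K L)) π)
    (hram : RamCond vd K L emb 0)
    (χ : (L ≃ₐ[K] L) →* A) (hχ : χ ≠ 1) :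
    ∃ α β : L, 0 ≤ vd.v (emb α) ∧ 0 ≤ vd.v (emb β) ∧
      vd.v (localResolvent K L emb (⇑χ) α)
          + vd.v (localResolvent K L emb (fun γ => χ γ⁻¹) β)
        = vd.v ((emb.comp (algebraMap K L)) π) ∧
      vd.v (∑ᶠ γ : L ≃ₐ[K] L,
          χ γ * (emb.comp (algebraMap K L)) (Algebra.trace K L (γ α * β)))
        = vd.v ((emb.comp (algebraMap K L)) π) := by
  obtain ⟨hm1, h0, -, hcard, -, h1⟩ := hram
  have hp1 : 1 ≤ p := (Fact.out : p.Prime).one_le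
  have hG : Nat.card (L ≃ₐ[K] L) = p - 1 := by
    have h1' : upperRamSet vd K L emb 1 = {1} := by simpa using h1
    rw [h0, h1'] at hcard
    simpa using hcard
  let f : ℤ_[p] →+* A := (emb.comp (algebraMap K L)).comp
    ((algebraMap ℚ_[p] K).comp (PadicInt.Coe.ringHom (p := p)))
  have hf : Function.Injective f :=
    (emb.comp (algebraMap K L)).injective.comp
      ((algebraMap ℚ_[p] K).injective.comp Subtype.val_injective)
  have hc : ∀ γ : L ≃ₐ[K] L, ∃ z : K, (emb.comp (algebraMap K L)) z = χ γ := by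
    intro γ
    have : χ γ ^ (p - 1) = 1 := by
      rw [← map_pow, ← hG, pow_card_eq_one', map_one]
    obtain ⟨z, hz⟩ := aux_roots_lift f hf _ this
    exact ⟨_, hz⟩
  choose c0 hc0 using hc
  have einj := (emb.comp (algebraMap K L)).injective
  let c : (L ≃ₐ[K] L) →* K :=
    { toFun := c0
      map_one' := einj (by rw [hc0, map_one, map_one])
      map_mul' := fun a b => einj (by rw [hc0, map_mul, map_mul, hc0, hc0]) }
  have hcχ : ∀ γ, χ γ = emb (algebraMap K L (c γ)) := fun γ => (hc0 γ).symm
  have hcc : ∀ γ, c γ * c γ⁻¹ = 1 := fun γ => by rw [← map_mul, mul_inv_cancel, map_one]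
  obtain ⟨α0, hα0, hα0e⟩ := aux_eigen c
  obtain ⟨hπ0, hπpos, -⟩ := hπ
  set P : L := algebraMap K L π with hP
  have hP0 : P ≠ 0 := by simpa [hP] using hπ0
  obtain ⟨k, hk1, hk2⟩ := aux_scale vd emb P α0 hα0 hP0 hπpos
  set α := P ^ k * α0 with hα
  have hαne : α ≠ 0 := mul_ne_zero (zpow_ne_zero _ hP0) hα0
  have hPfix : ∀ γ : L ≃ₐ[K] L, γ P = P := fun γ => γ.commutes π
  have hαe : ∀ γ : L ≃ₐ[K] L, γ α = algebraMap K L (c γ⁻¹) * α := by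
    intro γ
    rw [hα, map_mul, map_zpow₀, hPfix, hα0e]; ring
  have hcL : ∀ γ, algebraMap K L (c γ) * algebraMap K L (c γ⁻¹) = 1 := fun γ => by
    rw [← map_mul, hcc, map_one]
  have hβe : ∀ γ : L ≃ₐ[K] L, γ (P / α) = algebraMap K L (c γ) * (P / α) := by
    intro γ
    rw [map_div₀, hPfix, hαe]
    have h2 : algebraMap K L (c γ⁻¹) ≠ 0 := right_ne_zero_of_mul_eq_one (hcL γ)
    have h3 : algebraMap K L (c γ) = (algebraMap K L (c γ⁻¹))⁻¹ := eq_inv_of_mul_eq_one_left (hcL γ)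
    rw [h3]
    field_simp
  have hFc : Fintype.card (L ≃ₐ[K] L) = p - 1 := by rw [← Nat.card_eq_fintype_card, hG]
  have hv := aux_v_pm1 hp1 vd
  have hr1 : localResolvent K L emb (⇑χ) α = ((p - 1 : ℕ) : A) * emb α := by
    rw [localResolvent, finsum_eq_sum_of_fintype, Finset.sum_congr rfl (g := fun _ => emb α)]
    · rw [Finset.sum_const, Finset.card_univ, hFc, nsmul_eq_mul]
    · intro γ _
      rw [hcχ, ← map_mul, hαe, ← mul_assoc, hcL, one_mul]
  have hr2 : localResolvent K L emb (fun γ => χ γ⁻¹) (P / α) = ((p - 1 : ℕ) : A) * emb (P / α) := by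
    rw [localResolvent, finsum_eq_sum_of_fintype, Finset.sum_congr rfl (g := fun _ => emb (P / α))]
    · rw [Finset.sum_const, Finset.card_univ, hFc, nsmul_eq_mul]
    · intro γ _
      rw [hcχ, ← map_mul, hβe, ← mul_assoc, mul_comm (algebraMap K L (c γ⁻¹)), hcL, one_mul]
  have hfin : Module.finrank K L = p - 1 := by
    rw [← IsGalois.card_aut_eq_finrank, hG]
  have hr3 : (∑ᶠ γ : L ≃ₐ[K] L,
          χ γ * (emb.comp (algebraMap K L)) (Algebra.trace K L (γ α * (P / α))))
      = ((p - 1 : ℕ) : A) * (((p - 1 : ℕ) : A) * emb P) := by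
    rw [finsum_eq_sum_of_fintype,
      Finset.sum_congr rfl (g := fun _ => ((p - 1 : ℕ) : A) * emb P)]
    · rw [Finset.sum_const, Finset.card_univ, hFc, nsmul_eq_mul]
    · intro γ _
      have e1 : γ α * (P / α) = algebraMap K L (c γ⁻¹ * π) := by
        rw [hαe, map_mul, mul_assoc, mul_div_cancel₀ _ hαne]
      rw [e1, Algebra.trace_algebraMap, hfin, hcχ, RingHom.comp_apply, ← map_mul, ← map_mul,
        nsmul_eq_mul, mul_left_comm, ← mul_assoc (c γ), hcc, one_mul, map_mul, map_mul,
        map_natCast, map_natCast]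
  refine ⟨α, P / α, hk1, hk2, ?_, ?_⟩
  · rw [hr1, hr2, vd.v_mul, vd.v_mul, hv, zero_add, zero_add, ← vd.v_mul, ← map_mul,
      mul_div_cancel₀ _ hαne]
    rfl
  · rw [hr3, vd.v_mul, vd.v_mul, hv, zero_add, zero_add]
    rfl

end
end
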